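/- arXiv:1811.00886 — 13 statements merged into one kernel-verified Lean document; each statement's English description precedes it below -/
import Mathlib

section
/- Define f : [0,1] × [0,1] → [0,1] by f(x,y) = x if y ≤ 1/2 or x ≥ 1/2, and f(x,y) = (1/2)·(2x)^{1+(y−1/2)} if x ≤ 1/2 and y ≥ 1/2. Then f is right self-distributive: f(f(x,y),z) = f(f(x,z),f(y,z)) for all x, y, z ∈ [0,1]. -/
open Set

/-- The quandle operation of Theorem 3.3: `f x y = x` if `y ≤ 1/2` or `x ≥ 1/2`,
and `f x y = (1/2)·(2x)^(1+(y-1/2))` otherwise (real power). -/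
noncomputable def f01 (x y : ℝ) : ℝ :=
  if y ≤ 1 / 2 ∨ 1 / 2 ≤ x then x else 1 / 2 * (2 * x) ^ (1 + (y - 1 / 2))

theorem f01_of_le {x y : ℝ} (h : y ≤ 1 / 2) : f01 x y = x := if_pos (Or.inl h)

theorem f01_of_half_le {x y : ℝ} (h : 1 / 2 ≤ x) : f01 x y = x := if_pos (Or.inr h)

theorem f01_of_lt {x y : ℝ} (hx : x < 1 / 2) (hy : 1 / 2 < y) :
    f01 x y = 1 / 2 * (2 * x) ^ (1 + (y - 1 / 2)) :=
  if_neg (by rintro (h | h) <;> linarith)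

theorem f01_lt_half {x y : ℝ} (h0 : 0 ≤ x) (hx : x < 1 / 2) : f01 x y < 1 / 2 := by
  rcases le_or_gt y (1 / 2) with hy | hy
  · rwa [f01_of_le hy]
  · rw [f01_of_lt hx hy]
    have := Real.rpow_lt_one (x := 2 * x) (z := 1 + (y - 1 / 2))
      (by linarith) (by linarith) (by linarith)
    linarith

/-- The right translations of `f01` commute on `[0, 1/2)`. -/
theorem f01_right_comm {x y z : ℝ} (h0 : 0 ≤ x) (hx : x < 1 / 2) :
    f01 (f01 x y) z = f01 (f01 x z) y := by
  rcases le_or_gt y (1 / 2) with hy | hy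
  · rw [f01_of_le hy, f01_of_le hy]
  rcases le_or_gt z (1 / 2) with hz | hz
  · rw [f01_of_le hz, f01_of_le hz]
  rw [f01_of_lt (f01_lt_half h0 hx) hz, f01_of_lt (f01_lt_half h0 hx) hy,
    f01_of_lt hx hy, f01_of_lt hx hz, ← mul_assoc, ← mul_assoc,
    mul_one_div_cancel two_ne_zero, one_mul, one_mul,
    ← Real.rpow_mul (by linarith), ← Real.rpow_mul (by linarith), mul_comm (1 + (y - 1 / 2))]

/-- `f01` is right self-distributive on `[0,1]`. -/
theorem stmt1 :
    ∀ x ∈ Icc (0 : ℝ) 1, ∀ y ∈ Icc (0 : ℝ) 1, ∀ z ∈ Icc (0 : ℝ) 1,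
      f01 (f01 x y) z = f01 (f01 x z) (f01 y z) := by
  intro x hx y hy z _
  rcases le_or_gt (1 / 2) x with h | h
  · simp only [f01_of_half_le h]
  rcases le_or_gt (1 / 2) y with h' | h'
  · rw [f01_of_half_le h', f01_right_comm hx.1 h]
  · rw [f01_of_le h'.le, f01_of_le (f01_lt_half hy.1 h').le]
end

section
/- There exists a nontrivial topological quandle operation on the closed unit interval [0,1]; that is, there exists a continuous map f : [0,1] × [0,1] → [0,1] such that f(x,x) = x for all x, f(f(x,y),z) = f(f(x,z),f(y,z)) for all x, y, z, for each y the map x ↦ f(x,y) is a homeomorphism of [0,1], and f(x₀,y₀) ≠ x₀ for some x₀, y₀ ∈ [0,1]. (This disproves the conjecture that the only topological quandle operation on [0,1] is the trivial one.) -/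
open Set

/-- A topological quandle operation on a topological space `X`: a continuous binary
operation which is idempotent, right self-distributive, and whose right translations
are homeomorphisms of `X`. -/
def IsTopQuandleOp {X : Type*} [TopologicalSpace X] (f : X → X → X) : Prop :=
  Continuous (fun p : X × X => f p.1 p.2) ∧
  (∀ x, f x x = x) ∧
  (∀ x y z, f (f x y) z = f (f x z) (f y z)) ∧
  (∀ y, ∃ h : X ≃ₜ X, ∀ x, h x = f x y)

/-- The homeomorphism of the unit interval acting on `[0, 1/2]` as the rescaled power map with
exponent `s` and fixing `[1/2, 1]` pointwise. -/
noncomputable def halfPow (s x : ℝ) : ℝ := (min (2 * x) 1) ^ s / 2 + max (x - 1 / 2) 0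

/-- An exponent which is constantly `1` on `[0, 1/2]`. -/
noncomputable def halfExponent (y : ℝ) : ℝ := max 1 (y + 1 / 2)

lemma halfExponent_pos (y : ℝ) : 0 < halfExponent y := lt_max_of_lt_left one_pos

lemma halfPow_of_le {x : ℝ} (s : ℝ) (h : x ≤ 1 / 2) : halfPow s x = (2 * x) ^ s / 2 := by
  rw [halfPow, min_eq_left (by linarith), max_eq_right (by linarith), add_zero]

lemma halfPow_of_ge {x : ℝ} (s : ℝ) (h : 1 / 2 ≤ x) : halfPow s x = x := by
  rw [halfPow, min_eq_right (by linarith), max_eq_left (by linarith), Real.one_rpow]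
  ring

lemma halfPow_le_half {s x : ℝ} (hs : 0 < s) (h0 : 0 ≤ x) (h : x ≤ 1 / 2) :
    halfPow s x ≤ 1 / 2 := by
  have := Real.rpow_le_one (by linarith : 0 ≤ 2 * x) (by linarith) hs.le
  rw [halfPow_of_le s h]
  linarith

lemma halfPow_mem {s x : ℝ} (hs : 0 < s) (hx : x ∈ Icc (0 : ℝ) 1) :
    halfPow s x ∈ Icc (0 : ℝ) 1 := by
  rcases le_total x (1 / 2) with h | h
  · refine ⟨?_, (halfPow_le_half hs hx.1 h).trans (by norm_num)⟩
    have := Real.rpow_nonneg (by linarith [hx.1] : 0 ≤ 2 * x) s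
    rw [halfPow_of_le s h]
    linarith
  · rwa [halfPow_of_ge s h]

lemma halfPow_halfPow {s t x : ℝ} (ht : 0 < t) (hx : 0 ≤ x) :
    halfPow s (halfPow t x) = halfPow (t * s) x := by
  rcases le_total x (1 / 2) with h | h
  · rw [halfPow_of_le s (halfPow_le_half ht hx h), halfPow_of_le t h, halfPow_of_le _ h,
      mul_div_cancel₀ _ two_ne_zero, Real.rpow_mul (by linarith)]
  · simp only [halfPow_of_ge _ h]

lemma halfPow_one (x : ℝ) : halfPow 1 x = x := by
  rcases le_total x (1 / 2) with h | h
  · rw [halfPow_of_le 1 h, Real.rpow_one]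
    ring
  · exact halfPow_of_ge 1 h

lemma halfExponent_of_le {y : ℝ} (h : y ≤ 1 / 2) : halfExponent y = 1 :=
  max_eq_left (by linarith)

lemma halfExponent_halfPow {t y : ℝ} (ht : 0 < t) (hy : 0 ≤ y) :
    halfExponent (halfPow t y) = halfExponent y := by
  rcases le_total y (1 / 2) with h | h
  · rw [halfExponent_of_le h, halfExponent_of_le (halfPow_le_half ht hy h)]
  · rw [halfPow_of_ge t h]

lemma Continuous.halfPow {X : Type*} [TopologicalSpace X] {s g : X → ℝ} (hs : Continuous s)
    (hg : Continuous g) (hpos : ∀ a, 0 < s a) : Continuous fun a => halfPow (s a) (g a) := by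
  unfold _root_.halfPow
  have h : Continuous fun a => (min (2 * g a) 1) ^ s a :=
    (by fun_prop : Continuous fun a => min (2 * g a) 1).rpow hs fun a => Or.inr (hpos a)
  fun_prop

/-- `halfPow s` as a homeomorphism of the unit interval. -/
noncomputable def halfPowHomeomorph (s : ℝ) (hs : 0 < s) : unitInterval ≃ₜ unitInterval where
  toFun x := ⟨halfPow s x, halfPow_mem hs x.2⟩
  invFun x := ⟨halfPow s⁻¹ x, halfPow_mem (inv_pos.2 hs) x.2⟩
  left_inv x := Subtype.ext <| by
    simp only [halfPow_halfPow hs x.2.1, mul_inv_cancel₀ hs.ne', halfPow_one]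
  right_inv x := Subtype.ext <| by
    simp only [halfPow_halfPow (inv_pos.2 hs) x.2.1, inv_mul_cancel₀ hs.ne', halfPow_one]
  continuous_toFun :=
    (continuous_const.halfPow continuous_subtype_val fun _ => hs).subtype_mk _
  continuous_invFun :=
    (continuous_const.halfPow continuous_subtype_val fun _ => inv_pos.2 hs).subtype_mk _

/-- There is a nontrivial topological quandle operation on the closed unit interval. -/
theorem stmt4 :
    ∃ f : unitInterval → unitInterval → unitInterval,
      IsTopQuandleOp f ∧ ∃ x₀ y₀, f x₀ y₀ ≠ x₀ := by
  refine ⟨fun x y => ⟨halfPow (halfExponent y) x, halfPow_mem (halfExponent_pos y) x.2⟩,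
    ⟨?_, fun x => Subtype.ext ?_, fun x y z => Subtype.ext ?_,
      fun y => ⟨halfPowHomeomorph _ (halfExponent_pos y), fun _ => rfl⟩⟩,
    ⟨1 / 4, by norm_num, by norm_num⟩, 1, fun h => ?_⟩
  · refine (Continuous.halfPow ?_ (continuous_subtype_val.comp continuous_fst) fun _ => halfExponent_pos _).subtype_mk _
    unfold halfExponent
    fun_prop
  · rcases le_total (x : ℝ) (1 / 2) with h | h
    · simp only [halfExponent_of_le h, halfPow_one]
    · exact halfPow_of_ge _ h
  · simp only [halfExponent_halfPow (halfExponent_pos z) y.2.1,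
      halfPow_halfPow (halfExponent_pos _) x.2.1, mul_comm]
  · have h' : halfPow (halfExponent 1) (1 / 4) = 1 / 4 := congrArg Subtype.val h
    have hlt : (2 * (1 / 4) : ℝ) ^ halfExponent 1 < (2 * (1 / 4) : ℝ) ^ (1 : ℝ) :=
      Real.rpow_lt_rpow_of_exponent_gt (by norm_num) (by norm_num)
        (lt_max_of_lt_right (by norm_num))
    rw [halfPow_of_le _ (by norm_num)] at h'
    rw [Real.rpow_one] at hlt
    linarith
end

section
/- Let X be a topological space and X₁, X₂ subsets of X with X = X₁ ∪ X₂. Suppose φ assigns to each y ∈ X₂ a bijection φ_y : X₁ → X₁ such that: (a) φ_y ∘ φ_z = φ_z ∘ φ_y for all y, z ∈ X₂; (b) φ_y(x) = x whenever x ∈ X₁ ∩ X₂ (in particular φ_y is the identity for y ∈ X₁ ∩ X₂). Define ψ : X × X → X by ψ(x,y) = φ_y(x) if x ∈ X₁ and y ∈ X₂, and ψ(x,y) = x otherwise. Then ψ is well defined, satisfies ψ(x,x) = x for all x ∈ X, satisfies the right self-distributivity ψ(ψ(x,y),z) = ψ(ψ(x,z),ψ(y,z)) for all x, y, z ∈ X,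 and for each y ∈ X the map x ↦ ψ(x,y) is a bijection of X. -/
open Set Classical

/-- The general gluing construction: `X = X₁ ∪ X₂`, with `φ` assigning to each `y ∈ X₂`
a bijection of `X₁`, such that these bijections pairwise commute, each of them fixes
`X₁ ∩ X₂` pointwise, and `φ_y` is the identity on `X₁` for `y ∈ X₁ ∩ X₂`.  Then
`ψ(x,y) = φ_y(x)` for `x ∈ X₁, y ∈ X₂` and `ψ(x,y) = x` otherwise is an idempotent,
right self-distributive operation on `X` whose right translations are bijections. -/
theorem stmt6 (X : Type*) [TopologicalSpace X] (X₁ X₂ : Set X)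
    (hcover : X₁ ∪ X₂ = univ) (φ : X → X → X)
    (hbij : ∀ y ∈ X₂, Set.BijOn (φ y) X₁ X₁)
    (hcomm : ∀ y ∈ X₂, ∀ z ∈ X₂, ∀ x ∈ X₁, φ y (φ z x) = φ z (φ y x))
    (hfix : ∀ y ∈ X₂, ∀ x ∈ X₁ ∩ X₂, φ y x = x)
    (hid : ∀ y ∈ X₁ ∩ X₂, ∀ x ∈ X₁, φ y x = x) :
    let ψ : X → X → X := fun x y => if x ∈ X₁ ∧ y ∈ X₂ then φ y x else x
    (∀ x, ψ x x = x) ∧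
    (∀ x y z, ψ (ψ x y) z = ψ (ψ x z) (ψ y z)) ∧
    (∀ y, Function.Bijective (fun x => ψ x y)) := by
  intro ψ
  have hmaps : ∀ y ∈ X₂, ∀ x ∈ X₁, φ y x ∈ X₁ := fun y hy x hx => (hbij y hy).mapsTo hx
  have act : ∀ x ∈ X₁, ∀ y ∈ X₂, ψ x y = φ y x := fun x hx y hy => if_pos ⟨hx, hy⟩
  have triv_left : ∀ x ∉ X₁, ∀ y, ψ x y = x := fun x hx y => if_neg fun h => hx h.1
  have triv_right : ∀ y ∉ X₂, ∀ x, ψ x y = x := fun y hy x => if_neg fun h => hy h.2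
  have fix : ∀ x ∈ X₂, ∀ y, ψ x y = x := by
    intro x hx y
    by_cases h : x ∈ X₁ ∧ y ∈ X₂
    · rw [act x h.1 y h.2, hfix y h.2 x ⟨h.1, hx⟩]
    · exact if_neg h
  have triv_of_mem : ∀ y ∈ X₁, ∀ x, ψ x y = x := by
    intro y hy x
    by_cases h : x ∈ X₁ ∧ y ∈ X₂
    · rw [act x h.1 y h.2, hid y ⟨hy, h.2⟩ x h.1]
    · exact if_neg h
  refine ⟨fun x => ?_, fun x y z => ?_, fun y => ?_⟩
  · by_cases hx : x ∈ X₁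
    · exact triv_of_mem x hx x
    · exact triv_left x hx x
  · by_cases hx : x ∈ X₁
    swap
    · simp only [triv_left x hx]
    by_cases hz : z ∈ X₂
    swap
    · simp only [triv_right z hz]
    by_cases hy : y ∈ X₂
    · rw [fix y hy z, act x hx y hy, act x hx z hz, act _ (hmaps y hy x hx) z hz,
        act _ (hmaps z hz x hx) y hy, hcomm z hz y hy x hx]
    · have hy₁ : y ∈ X₁ := (hcover ▸ mem_univ y : y ∈ X₁ ∪ X₂).resolve_right hy
      rw [triv_right y hy, act y hy₁ z hz, triv_of_mem _ (hmaps z hz y hy₁)]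
  · by_cases hy : y ∈ X₂
    swap
    · simp only [triv_right y hy]
      exact Function.bijective_id
    have on : BijOn (fun x => ψ x y) X₁ X₁ :=
      (hbij y hy).congr fun x hx => (act x hx y hy).symm
    have off : BijOn (fun x => ψ x y) X₁ᶜ X₁ᶜ :=
      (bijOn_id _).congr fun x hx => (triv_left x hx y).symm
    have inj : InjOn (fun x => ψ x y) (X₁ ∪ X₁ᶜ) := by
      refine (injOn_union disjoint_compl_right).2 ⟨on.injOn, off.injOn, ?_⟩
      intro a ha b hb h
      exact off.mapsTo hb (h ▸ on.mapsTo ha)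
    have := on.union off inj
    rwa [union_compl_self, bijOn_univ] at this
end

section
/- Define g : (−1,1) × (−1,1) → (−1,1) by g(x,y) = x if y ≤ 0 or x ≥ 0, and g(x,y) = −1 + (x+1)^{1+y(1−y²)} if x ≤ 0 and y ≥ 0. Then g is a nontrivial topological quandle operation on the open interval (−1,1): it is continuous, g(x,x) = x for all x, g(g(x,y),z) = g(g(x,z),g(y,z)) for all x, y, z, each right translation x ↦ g(x,y) is a homeomorphism of (−1,1), and g(x₀,y₀) ≠ x₀ for some x₀, y₀. -/
open Set

/-- The quandle operation `g_{(-1,1)}` of Remark 3.5 on the open interval `(-1,1)`: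
`g x y = x` if `y ≤ 0` or `x ≥ 0`, and `g x y = -1 + (x+1)^(1+y(1-y²))` otherwise. -/
noncomputable def gop (x y : ℝ) : ℝ :=
  if y ≤ 0 ∨ 0 ≤ x then x else -1 + (x + 1) ^ (1 + y * (1 - y ^ 2))

/-- The map that is the identity on `[0, ∞)` and `x ↦ (x + 1) ^ a - 1` on `(-1, 0]`. -/
noncomputable def negPow (a x : ℝ) : ℝ :=
  max x 0 + (min x 0 + 1) ^ a - 1

/-- The exponent `1 + y (1 - y²)` for `y ≥ 0`, extended by `1` to `y ≤ 0`. -/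
noncomputable def gopExponent (y : ℝ) : ℝ :=
  1 + max y 0 * (1 - max y 0 ^ 2)

theorem negPow_of_nonneg (a : ℝ) {x : ℝ} (hx : 0 ≤ x) : negPow a x = x := by
  simp [negPow, hx]

theorem negPow_of_nonpos (a : ℝ) {x : ℝ} (hx : x ≤ 0) : negPow a x = (x + 1) ^ a - 1 := by
  simp [negPow, hx]

theorem negPow_one (x : ℝ) : negPow 1 x = x := by
  rw [negPow, Real.rpow_one]
  linarith [max_add_min x 0]

theorem neg_one_lt_negPow (a : ℝ) {x : ℝ} (hx : -1 < x) : -1 < negPow a x := by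
  rcases le_total 0 x with h | h
  · rwa [negPow_of_nonneg a h]
  · rw [negPow_of_nonpos a h]
    linarith [Real.rpow_pos_of_pos (show 0 < x + 1 by linarith) a]

theorem negPow_nonpos {a x : ℝ} (ha : 0 ≤ a) (hx : -1 < x) (hx0 : x ≤ 0) :
    negPow a x ≤ 0 := by
  rw [negPow_of_nonpos a hx0]
  linarith [Real.rpow_le_one (show 0 ≤ x + 1 by linarith) (show x + 1 ≤ 1 by linarith) ha]

theorem negPow_mem_Ioo {a x : ℝ} (ha : 0 ≤ a) (hx : x ∈ Ioo (-1 : ℝ) 1) :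
    negPow a x ∈ Ioo (-1 : ℝ) 1 := by
  refine ⟨neg_one_lt_negPow a hx.1, ?_⟩
  rcases le_total 0 x with h | h
  · rw [negPow_of_nonneg a h]
    exact hx.2
  · linarith [negPow_nonpos ha hx.1 h]

theorem negPow_negPow (a : ℝ) {b x : ℝ} (hb : 0 ≤ b) (hx : -1 < x) :
    negPow a (negPow b x) = negPow (b * a) x := by
  rcases le_total 0 x with h | h
  · simp only [negPow_of_nonneg _ h]
  · rw [negPow_of_nonpos a (negPow_nonpos hb hx h), negPow_of_nonpos b h,
      negPow_of_nonpos _ h, sub_add_cancel, ← Real.rpow_mul (by linarith)]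

theorem max_negPow_zero {a x : ℝ} (ha : 0 ≤ a) (hx : -1 < x) :
    max (negPow a x) 0 = max x 0 := by
  rcases le_total 0 x with h | h
  · rw [negPow_of_nonneg a h]
  · rw [max_eq_right (negPow_nonpos ha hx h), max_eq_right h]

theorem continuousOn_negPow :
    ContinuousOn (fun p : ℝ × ℝ => negPow p.1 p.2) (univ ×ˢ Ioi (-1)) := by
  unfold negPow
  refine ((by fun_prop : ContinuousOn _ _).add
    (ContinuousOn.rpow (by fun_prop) (by fun_prop) ?_)).sub continuousOn_const
  rintro ⟨a, x⟩ ⟨-, hx⟩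
  left
  have : -1 < min x 0 := lt_min hx (by norm_num)
  exact ne_of_gt (by simpa using neg_lt_iff_pos_add.mp this)

theorem continuous_gopExponent : Continuous gopExponent := by
  unfold gopExponent
  fun_prop

theorem one_le_gopExponent {y : ℝ} (hy : y < 1) : 1 ≤ gopExponent y := by
  have h0 : 0 ≤ max y 0 := le_max_right _ _
  have h1 : max y 0 < 1 := max_lt hy one_pos
  have : 0 ≤ max y 0 * (1 - max y 0 ^ 2) := mul_nonneg h0 (by nlinarith)
  unfold gopExponent
  linarith

theorem gopExponent_negPow {a y : ℝ} (ha : 0 ≤ a) (hy : -1 < y) :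
    gopExponent (negPow a y) = gopExponent y := by
  rw [gopExponent, max_negPow_zero ha hy, gopExponent]

theorem gop_eq_negPow (x y : ℝ) : gop x y = negPow (gopExponent y) x := by
  unfold gop
  split_ifs with h
  · rcases h with h | h
    · rw [gopExponent, max_eq_right h, zero_mul, add_zero, negPow_one]
    · rw [negPow_of_nonneg _ h]
  · push Not at h
    rw [negPow_of_nonpos _ h.2.le, gopExponent, max_eq_left h.1.le]
    ring

/-- The self-homeomorphism of `(-1, 1)` given by `negPow a` for `a > 0`. -/
noncomputable def negPowHomeomorph (a : ℝ) (ha : 0 < a) :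
    Ioo (-1 : ℝ) 1 ≃ₜ Ioo (-1 : ℝ) 1 where
  toFun x := ⟨negPow a x, negPow_mem_Ioo ha.le x.2⟩
  invFun x := ⟨negPow a⁻¹ x, negPow_mem_Ioo (inv_pos.mpr ha).le x.2⟩
  left_inv x := Subtype.ext <| by
    simp only [negPow_negPow _ ha.le x.2.1, mul_inv_cancel₀ ha.ne', negPow_one]
  right_inv x := Subtype.ext <| by
    simp only [negPow_negPow _ (inv_pos.mpr ha).le x.2.1, inv_mul_cancel₀ ha.ne', negPow_one]
  continuous_toFun := Continuous.subtype_mk (continuousOn_negPow.comp_continuous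
    (f := fun x : Ioo (-1 : ℝ) 1 => (a, (x : ℝ))) (by fun_prop)
    fun x => ⟨mem_univ _, x.2.1⟩) _
  continuous_invFun := Continuous.subtype_mk (continuousOn_negPow.comp_continuous
    (f := fun x : Ioo (-1 : ℝ) 1 => (a⁻¹, (x : ℝ))) (by fun_prop)
    fun x => ⟨mem_univ _, x.2.1⟩) _

/-- `g_{(-1,1)}` is a nontrivial topological quandle operation on `(-1,1)`:
it maps `(-1,1)²` into `(-1,1)`, is continuous there, idempotent, right
self-distributive, its right translations are homeomorphisms of `(-1,1)`,
and it is not trivial. -/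
theorem stmt8 :
    (∀ x ∈ Ioo (-1 : ℝ) 1, ∀ y ∈ Ioo (-1 : ℝ) 1, gop x y ∈ Ioo (-1 : ℝ) 1) ∧
    ContinuousOn (fun p : ℝ × ℝ => gop p.1 p.2) (Ioo (-1 : ℝ) 1 ×ˢ Ioo (-1 : ℝ) 1) ∧
    (∀ x ∈ Ioo (-1 : ℝ) 1, gop x x = x) ∧
    (∀ x ∈ Ioo (-1 : ℝ) 1, ∀ y ∈ Ioo (-1 : ℝ) 1, ∀ z ∈ Ioo (-1 : ℝ) 1,
      gop (gop x y) z = gop (gop x z) (gop y z)) ∧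
    (∀ y : Ioo (-1 : ℝ) 1, ∃ h : Ioo (-1 : ℝ) 1 ≃ₜ Ioo (-1 : ℝ) 1,
      ∀ x : Ioo (-1 : ℝ) 1, (h x : ℝ) = gop x y) ∧
    (∃ x₀ ∈ Ioo (-1 : ℝ) 1, ∃ y₀ ∈ Ioo (-1 : ℝ) 1, gop x₀ y₀ ≠ x₀) := by
  have hpos {y : ℝ} (hy : y ∈ Ioo (-1 : ℝ) 1) : 0 < gopExponent y :=
    one_pos.trans_le (one_le_gopExponent hy.2)
  simp only [gop_eq_negPow]
  refine ⟨fun x hx y hy => negPow_mem_Ioo (hpos hy).le hx, ?_, fun x hx => ?_,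
    fun x hx y hy z hz => ?_, fun y => ⟨negPowHomeomorph _ (hpos y.2), fun x => rfl⟩, ?_⟩
  · exact continuousOn_negPow.comp (f := fun p : ℝ × ℝ => (gopExponent p.2, p.1))
      ((continuous_gopExponent.comp continuous_snd).prodMk continuous_fst).continuousOn
      fun p hp => ⟨mem_univ _, hp.1.1⟩
  · rw [← gop_eq_negPow, gop, if_pos (le_total x 0)]
  · rw [gopExponent_negPow (hpos hz).le hy.1, negPow_negPow _ (hpos hy).le hx.1,
      negPow_negPow _ (hpos hz).le hx.1, mul_comm]
  · refine ⟨-1 / 2, by norm_num, 1 / 2, by norm_num, ne_of_lt ?_⟩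
    have he : 1 < gopExponent (1 / 2) := by norm_num [gopExponent]
    rw [negPow_of_nonpos _ (by norm_num)]
    have := Real.rpow_lt_rpow_of_exponent_gt (x := (-1 / 2 + 1 : ℝ)) (by norm_num)
      (by norm_num) he
    rw [Real.rpow_one] at this
    linarith
end

section
/- Define G : [−1,1] × [−1,1] → [−1,1] by G(x,y) = x if |x| = 1 or |y| = 1 or y ≤ 0 or x ≥ 0, and G(x,y) = −1 + (x+1)^{1+y(1−y²)} if −1 < x ≤ 0 and 0 ≤ y < 1. Then G is continuous on [−1,1] × [−1,1]; in other words, the quandle operation g(x,y) on (−1,1) given by the same formulas satisfies g(x,y) → x as x or y approaches an endpoint ±1. -/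
open Set

/-- The extension `G` of `g_{(-1,1)}` to `[-1,1]` which equals the first argument on
the boundary. -/
noncomputable def Gop (x y : ℝ) : ℝ :=
  if |x| = 1 ∨ |y| = 1 ∨ y ≤ 0 ∨ 0 ≤ x then x else -1 + (x + 1) ^ (1 + y * (1 - y ^ 2))

/-- On the closed square, `G` is given by a single formula in the positive and negative parts
of its arguments. -/
theorem Gop_eq_max_add_rpow {x y : ℝ} (hx : x ∈ Icc (-1 : ℝ) 1) (hy : y ∈ Icc (-1 : ℝ) 1) :
    Gop x y = max x 0 + (-1 + (min x 0 + 1) ^ (1 + max y 0 * (1 - max y 0 ^ 2))) := by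
  obtain ⟨hx₁, hx₂⟩ := hx
  obtain ⟨hy₁, hy₂⟩ := hy
  unfold Gop
  rcases le_total 0 x with h0x | hx0
  · simp [h0x]
  rcases le_total y 0 with hy0 | h0y
  · simp [hx0, hy0]
  rw [max_eq_right hx0, min_eq_left hx0, max_eq_left h0y, zero_add]
  split_ifs with h
  · rcases h with h | h | h | h
    · obtain rfl : x = -1 := by rw [abs_of_nonpos hx0] at h; linarith
      have hexp : 1 + y * (1 - y ^ 2) ≠ 0 := by
        have : 0 ≤ y * (1 - y ^ 2) := mul_nonneg h0y (by nlinarith)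
        linarith
      simp [Real.zero_rpow hexp]
    · obtain rfl : y = 1 := by rwa [abs_of_nonneg h0y] at h
      simp
    · obtain rfl : y = 0 := le_antisymm h h0y
      simp
    · obtain rfl : x = 0 := le_antisymm hx0 h
      simp
  · rfl

/-- `G` is continuous on `[-1,1] × [-1,1]`; in other words the quandle operation `g`
on `(-1,1)` satisfies `g(x,y) → x` as `x` or `y` approaches an endpoint `±1`. -/
theorem stmt9 :
    ContinuousOn (fun p : ℝ × ℝ => Gop p.1 p.2) (Icc (-1 : ℝ) 1 ×ˢ Icc (-1 : ℝ) 1) ∧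
    ∀ x ∈ Ioo (-1 : ℝ) 1, ∀ y ∈ Ioo (-1 : ℝ) 1, Gop x y = gop x y := by
  refine ⟨?_, fun x hx y hy => ?_⟩
  · refine ContinuousOn.congr (f := fun p : ℝ × ℝ => max p.1 0 +
      (-1 + (min p.1 0 + 1) ^ (1 + max p.2 0 * (1 - max p.2 0 ^ 2)))) ?_
      fun p hp => Gop_eq_max_add_rpow hp.1 hp.2
    refine ContinuousOn.add (by fun_prop) (continuousOn_const.add ?_)
    refine ContinuousOn.rpow (by fun_prop) (by fun_prop) fun p hp => Or.inr ?_
    have h0 : 0 ≤ max p.2 0 := le_max_right _ _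
    have h1 : max p.2 0 ≤ 1 := max_le hp.2.2 zero_le_one
    have : 0 ≤ max p.2 0 * (1 - max p.2 0 ^ 2) := mul_nonneg h0 (by nlinarith)
    linarith
  · have hx' : |x| ≠ 1 := (abs_lt.2 hx).ne
    have hy' : |y| ≠ 1 := (abs_lt.2 hy).ne
    simp [Gop, gop, hx', hy']
end

section
/- Let a < b be real numbers. There exist infinitely many pairwise nonisomorphic nontrivial topological quandle structures on the closed interval [a,b]; that is, there exists a sequence (Fₙ)_{n≥1} of topological quandle operations on [a,b], each nontrivial, such that for all m ≠ n there is no homeomorphism φ : [a,b] → [a,b] with φ(Fₘ(x,y)) = Fₙ(φ(x),φ(y)) for all x, y ∈ [a,b]. -/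
open Set

/-- The map fixing `x ≤ 0` and sending `x ≥ 0` to `x ^ p`. -/
noncomputable def powFlow (p x : ℝ) : ℝ := min x 0 + max x 0 ^ p

lemma powFlow_of_nonpos {p x : ℝ} (hp : 0 < p) (hx : x ≤ 0) : powFlow p x = x := by
  simp [powFlow, hx, Real.zero_rpow hp.ne']

lemma powFlow_of_nonneg {p x : ℝ} (hx : 0 ≤ x) : powFlow p x = x ^ p := by
  simp [powFlow, hx]

lemma powFlow_one (x : ℝ) : powFlow 1 x = x := by
  simp [powFlow, min_add_max]

lemma powFlow_powFlow {p q : ℝ} (hp : 0 < p) (hq : 0 < q) (x : ℝ) :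
    powFlow p (powFlow q x) = powFlow (q * p) x := by
  rcases le_total x 0 with hx | hx
  · rw [powFlow_of_nonpos hq hx, powFlow_of_nonpos hp hx, powFlow_of_nonpos (mul_pos hq hp) hx]
  · rw [powFlow_of_nonneg hx, powFlow_of_nonneg (Real.rpow_nonneg hx q), powFlow_of_nonneg hx,
      Real.rpow_mul hx]

lemma powFlow_mem_Icc {p x : ℝ} (hp : 0 < p) (hx : x ∈ Icc (-1 : ℝ) 1) :
    powFlow p x ∈ Icc (-1 : ℝ) 1 := by
  rcases le_total x 0 with h | h
  · rwa [powFlow_of_nonpos hp h]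
  · rw [powFlow_of_nonneg h]
    exact ⟨by linarith [Real.rpow_nonneg h p], Real.rpow_le_one h hx.2 hp.le⟩

lemma Continuous.powFlow {X : Type*} [TopologicalSpace X] {p f : X → ℝ} (hp : Continuous p)
    (hf : Continuous f) (hpos : ∀ x, 0 < p x) : Continuous fun x => powFlow (p x) (f x) :=
  (hf.min continuous_const).add
    ((hf.max continuous_const).rpow hp fun x => Or.inr (hpos x))

lemma powFlow_eq_self_iff {p x : ℝ} (hx₀ : 0 < x) (hx₁ : x < 1) : powFlow p x = x ↔ p = 1 := by
  rw [powFlow_of_nonneg hx₀.le]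
  nth_rewrite 2 [← Real.rpow_one x]
  exact Real.rpow_right_inj hx₀ hx₁.ne

/-- `powFlow p` as a self-homeomorphism of `[-1, 1]`. -/
noncomputable def powFlowHomeo (p : ℝ) (hp : 0 < p) : Icc (-1 : ℝ) 1 ≃ₜ Icc (-1 : ℝ) 1 where
  toFun x := ⟨powFlow p x, powFlow_mem_Icc hp x.2⟩
  invFun x := ⟨powFlow p⁻¹ x, powFlow_mem_Icc (inv_pos.2 hp) x.2⟩
  left_inv x := Subtype.ext <| by
    simp [powFlow_powFlow (inv_pos.2 hp) hp, hp.ne', powFlow_one]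
  right_inv x := Subtype.ext <| by
    simp [powFlow_powFlow hp (inv_pos.2 hp), hp.ne', powFlow_one]
  continuous_toFun :=
    (continuous_const.powFlow continuous_subtype_val fun _ => hp).subtype_mk _
  continuous_invFun :=
    (continuous_const.powFlow continuous_subtype_val fun _ => inv_pos.2 hp).subtype_mk _

/-- A continuous exponent which equals `1` exactly on `[0, ∞)` and at the points `-1 / (i + 2)`
with `i < n`. -/
noncomputable def exponent (n : ℕ) (y : ℝ) : ℝ :=
  1 + max (-y) 0 * ∏ i ∈ Finset.range n, (y + 1 / ((i : ℝ) + 2)) ^ 2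

lemma exponent_pos (n : ℕ) (y : ℝ) : 0 < exponent n y := by
  have := mul_nonneg (le_max_right (-y) 0)
    (Finset.prod_nonneg fun i (_ : i ∈ Finset.range n) => sq_nonneg (y + 1 / ((i : ℝ) + 2)))
  unfold exponent
  linarith

lemma continuous_exponent (n : ℕ) : Continuous (exponent n) := by
  unfold exponent
  fun_prop

lemma exponent_of_nonneg (n : ℕ) {y : ℝ} (hy : 0 ≤ y) : exponent n y = 1 := by
  simp [exponent, hy]

lemma exponent_eq_one_iff (n : ℕ) (y : ℝ) :
    exponent n y = 1 ↔ 0 ≤ y ∨ ∃ i < n, y = -(1 / ((i : ℝ) + 2)) := by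
  simp only [exponent, add_eq_left, mul_eq_zero, Finset.prod_eq_zero_iff, Finset.mem_range,
    sq_eq_zero_iff, max_eq_right_iff, neg_nonpos, add_eq_zero_iff_eq_neg]

lemma exponent_neg_one_ne_one (n : ℕ) : exponent n (-1) ≠ 1 := by
  rw [Ne, exponent_eq_one_iff]
  rintro (h | ⟨i, -, h⟩)
  · linarith
  · field_simp at h
    have : (0 : ℝ) ≤ i := i.cast_nonneg
    linarith

lemma exponent_powFlow (n : ℕ) {p : ℝ} (hp : 0 < p) (y : ℝ) :
    exponent n (powFlow p y) = exponent n y := by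
  rcases le_total y 0 with hy | hy
  · rw [powFlow_of_nonpos hp hy]
  · rw [powFlow_of_nonneg hy, exponent_of_nonneg n hy,
      exponent_of_nonneg n (Real.rpow_nonneg hy p)]

/-- The quandle operation on `[-1, 1]` in which `y` acts as `powFlow (exponent n y)`. -/
noncomputable def powOp (n : ℕ) (x y : Icc (-1 : ℝ) 1) : Icc (-1 : ℝ) 1 :=
  powFlowHomeo (exponent n y) (exponent_pos n y) x

lemma coe_powOp (n : ℕ) (x y : Icc (-1 : ℝ) 1) :
    (powOp n x y : ℝ) = powFlow (exponent n y) x := rfl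

lemma isTopQuandleOp_powOp (n : ℕ) : IsTopQuandleOp (powOp n) := by
  refine ⟨?_, fun x => Subtype.ext ?_, fun x y z => Subtype.ext ?_,
    fun y => ⟨powFlowHomeo _ (exponent_pos n y), fun _ => rfl⟩⟩
  · exact (((continuous_exponent n).comp (by fun_prop)).powFlow (by fun_prop)
      fun _ => exponent_pos n _).subtype_mk _
  · rw [coe_powOp]
    rcases le_total (x : ℝ) 0 with h | h
    · exact powFlow_of_nonpos (exponent_pos n x) h
    · rw [exponent_of_nonneg n h, powFlow_one]
  · simp only [coe_powOp]
    rw [exponent_powFlow n (exponent_pos n z), powFlow_powFlow (exponent_pos n z) (exponent_pos n y),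
      powFlow_powFlow (exponent_pos n y) (exponent_pos n z), mul_comm]

/-- The elements which act trivially and are fixed by every right translation. -/
def inertSet {X : Type*} (f : X → X → X) : Set X :=
  {y | (∀ x, f x y = x) ∧ ∀ z, f y z = y}

lemma ncard_inertSet_eq {X Y : Type*} {f : X → X → X} {g : Y → Y → Y} (e : X ≃ Y)
    (he : ∀ x y, e (f x y) = g (e x) (e y)) : (inertSet f).ncard = (inertSet g).ncard := by
  have : inertSet f = e ⁻¹' inertSet g := by
    ext y
    simp [inertSet, e.surjective.forall, ← he]
  rw [this, ← e.image_symm_eq_preimage, ncard_image_of_injective _ e.symm.injective]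

lemma IsTopQuandleOp.conj {X Y : Type*} [TopologicalSpace X] [TopologicalSpace Y]
    {f : X → X → X} (hf : IsTopQuandleOp f) (e : Y ≃ₜ X) :
    IsTopQuandleOp fun x y => e.symm (f (e x) (e y)) := by
  obtain ⟨hcont, hidem, hdist, hhomeo⟩ := hf
  refine ⟨?_, by simp [hidem], fun x y z => by simpa using hdist (e x) (e y) (e z), fun y => ?_⟩
  · exact e.symm.continuous.comp <| hcont.comp
      ((e.continuous.comp continuous_fst).prodMk (e.continuous.comp continuous_snd))
  · obtain ⟨h, hh⟩ := hhomeo (e y)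
    exact ⟨(e.trans h).trans e.symm, fun x => by simp [hh]⟩

lemma coe_image_inertSet_powOp (n : ℕ) :
    (↑) '' inertSet (powOp n) =
      insert (0 : ℝ) (insert 1 ((fun i : ℕ => -(1 / ((i : ℝ) + 2))) '' Iio n)) := by
  ext y
  simp only [mem_image, inertSet, mem_ofPred_eq, Subtype.ext_iff, coe_powOp, mem_insert_iff, mem_Iio]
  constructor
  · rintro ⟨y, ⟨hact, hfix⟩, rfl⟩
    have hone := (powFlow_eq_self_iff (by norm_num) (by norm_num)).1
      (hact ⟨1 / 2, by norm_num, by norm_num⟩)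
    rcases (exponent_eq_one_iff n y).1 hone with h | ⟨i, hi, h⟩
    · rcases h.eq_or_lt with h₀ | h₀
      · exact Or.inl h₀.symm
      · rcases y.2.2.eq_or_lt with h₁ | h₁
        · exact Or.inr (Or.inl h₁)
        · exact absurd ((powFlow_eq_self_iff h₀ h₁).1 (hfix ⟨-1, by norm_num, by norm_num⟩))
            (exponent_neg_one_ne_one n)
    · exact Or.inr (Or.inr ⟨i, hi, h.symm⟩)
  · rintro (rfl | rfl | ⟨i, hi, rfl⟩)
    · refine ⟨⟨0, by norm_num, by norm_num⟩, ⟨fun x => ?_, fun z => ?_⟩, rfl⟩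
      · rw [exponent_of_nonneg n le_rfl, powFlow_one]
      · exact powFlow_of_nonpos (exponent_pos n z) le_rfl
    · refine ⟨⟨1, by norm_num, by norm_num⟩, ⟨fun x => ?_, fun z => ?_⟩, rfl⟩
      · rw [exponent_of_nonneg n zero_le_one, powFlow_one]
      · rw [powFlow_of_nonneg zero_le_one, Real.one_rpow]
    · have hpos : 0 < 1 / ((i : ℝ) + 2) := by positivity
      have hle : 1 / ((i : ℝ) + 2) ≤ 1 := by
        rw [div_le_one (by positivity)]
        linarith [(i.cast_nonneg : (0 : ℝ) ≤ i)]
      refine ⟨⟨-(1 / ((i : ℝ) + 2)), by linarith, by linarith⟩, ⟨fun x => ?_, fun z => ?_⟩, rfl⟩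
      · rw [(exponent_eq_one_iff n _).2 (Or.inr ⟨i, hi, rfl⟩), powFlow_one]
      · exact powFlow_of_nonpos (exponent_pos n z) (by linarith)

lemma ncard_inertSet_powOp (n : ℕ) : (inertSet (powOp n)).ncard = n + 2 := by
  have hneg (i : ℕ) : -(1 / ((i : ℝ) + 2)) < 0 := by
    rw [neg_lt_zero]
    positivity
  have hinj : Function.Injective fun i : ℕ => -(1 / ((i : ℝ) + 2)) := fun i j h => by
    simpa using h
  have hfin : ((fun i : ℕ => -(1 / ((i : ℝ) + 2))) '' Iio n).Finite := (finite_Iio n).image _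
  rw [← ncard_image_of_injective _ Subtype.val_injective, coe_image_inertSet_powOp,
    ncard_insert_of_notMem _ (hfin.insert 1), ncard_insert_of_notMem _ hfin,
    ncard_image_of_injective _ hinj]
  · simp [ncard_eq_toFinset_card']
  · rintro ⟨i, -, h⟩
    linarith [hneg i]
  · rintro (h | ⟨i, -, h⟩)
    · exact zero_ne_one h
    · linarith [hneg i]

/-- There are infinitely many pairwise nonisomorphic nontrivial topological quandle
structures on a closed interval `[a,b]`. -/
theorem stmt11 (a b : ℝ) (hab : a < b) :
    ∃ F : ℕ → (Icc a b → Icc a b → Icc a b),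
      (∀ n, IsTopQuandleOp (F n) ∧ ∃ x₀ y₀, F n x₀ y₀ ≠ x₀) ∧
      (∀ m n, m ≠ n →
        ¬∃ φ : Icc a b ≃ₜ Icc a b, ∀ x y, φ (F m x y) = F n (φ x) (φ y)) := by
  let e : Icc a b ≃ₜ Icc (-1 : ℝ) 1 :=
    (iccHomeoI a b hab).trans (iccHomeoI (-1) 1 (by norm_num)).symm
  refine ⟨fun n x y => e.symm (powOp n (e x) (e y)),
    fun n => ⟨(isTopQuandleOp_powOp n).conj e, e.symm ⟨1 / 2, by norm_num, by norm_num⟩,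
      e.symm ⟨-1, by norm_num, by norm_num⟩, fun h => ?_⟩, ?_⟩
  · rw [e.symm.injective.eq_iff, e.apply_symm_apply, e.apply_symm_apply, Subtype.ext_iff,
      coe_powOp, powFlow_eq_self_iff (by norm_num) (by norm_num)] at h
    exact exponent_neg_one_ne_one n h
  · rintro m n hmn ⟨φ, hφ⟩
    have h := ncard_inertSet_eq (f := powOp m) (g := powOp n)
      ((e.symm.trans φ).trans e).toEquiv fun x y => by
        simpa using congrArg e (hφ (e.symm x) (e.symm y))
    rw [ncard_inertSet_powOp, ncard_inertSet_powOp] at h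
    omega
end

section
/- Let n ≥ 1 and let B° be the open Euclidean unit ball in ℝⁿ. There exist infinitely many pairwise nonisomorphic nontrivial topological quandle structures on B°; that is, there exists a sequence (Ωₙ)_{n≥1} of topological quandle operations on B°, each nontrivial, such that for all m ≠ k there is no homeomorphism φ : B° → B° with φ(Ωₘ(x,y)) = Ω_k(φ(x),φ(y)) for all x, y ∈ B°. -/
open Set

/-- The Alexander quandle operation `(x, y) ↦ t x + (1 - t) y` on a real vector space. -/
def alexanderOp {E : Type*} [AddCommGroup E] [Module ℝ E] (t : ℝ) (x y : E) : E :=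
  t • x + (1 - t) • y

/-- Transport of a binary operation along a homeomorphism. -/
def transportOp {X Y : Type*} [TopologicalSpace X] [TopologicalSpace Y] (e : X ≃ₜ Y)
    (f : X → X → X) (x y : Y) : Y :=
  e (f (e.symm x) (e.symm y))

theorem IsTopQuandleOp.transportOp {X Y : Type*} [TopologicalSpace X] [TopologicalSpace Y]
    {f : X → X → X} (hf : IsTopQuandleOp f) (e : X ≃ₜ Y) :
    IsTopQuandleOp (transportOp e f) := by
  obtain ⟨hcont, hidem, hdist, hhomeo⟩ := hf
  refine ⟨?_, fun x => by simp [_root_.transportOp, hidem],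
    fun x y z => by simp [_root_.transportOp, hdist _ _ (e.symm z)], fun y => ?_⟩
  · exact e.continuous.comp (hcont.comp
      ((e.symm.continuous.comp continuous_fst).prodMk (e.symm.continuous.comp continuous_snd)))
  · obtain ⟨h, hh⟩ := hhomeo (e.symm y)
    exact ⟨(e.symm.trans h).trans e, fun x => by simp [_root_.transportOp, hh]⟩

section Alexander

variable {E : Type*} [NormedAddCommGroup E] [NormedSpace ℝ E]

theorem isTopQuandleOp_alexanderOp {t : ℝ} (ht : t ≠ 0) :
    IsTopQuandleOp (alexanderOp t : E → E → E) := by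
  refine ⟨?_, fun x => ?_, fun x y z => ?_, fun y => ?_⟩
  · unfold alexanderOp
    fun_prop
  · unfold alexanderOp
    module
  · unfold alexanderOp
    module
  · exact ⟨(Homeomorph.smulOfNeZero t ht).trans (Homeomorph.addRight ((1 - t) • y)),
      fun x => rfl⟩

/-- A continuous morphism of Alexander quandles that is not constant preserves the parameter. -/
theorem alexanderOp_param_eq {t s : ℝ} (ht : t ≠ 0) (ht1 : t ≠ 1) {φ : E → E}
    (hφ : Continuous φ) {v : E} (hv : φ v ≠ φ 0)
    (h : ∀ x y, φ (alexanderOp t x y) = alexanderOp s (φ x) (φ y)) : t = s := by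
  have ht1' : 1 - t ≠ 0 := sub_ne_zero.mpr ht1.symm
  let ψ : E → E := fun x => φ x - φ 0
  have hψ : ∀ x y, ψ (t • x + (1 - t) • y) = s • ψ x + (1 - s) • ψ y := fun x y => by
    have := h x y
    simp only [alexanderOp] at this
    simp only [ψ, this]
    module
  have hψ0 : ψ 0 = 0 := sub_self _
  have hleft : ∀ x, ψ (t • x) = s • ψ x := fun x => by simpa [hψ0] using hψ x 0
  have hright : ∀ y, ψ ((1 - t) • y) = (1 - s) • ψ y := fun y => by simpa [hψ0] using hψ 0 y
  have hadd : ∀ x y, ψ (x + y) = ψ x + ψ y := fun x y => by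
    have := hψ (t⁻¹ • x) ((1 - t)⁻¹ • y)
    rwa [← hleft, ← hright, smul_inv_smul₀ ht, smul_inv_smul₀ ht1'] at this
  have hsmul : ψ (t • v) = t • ψ v :=
    map_real_smul (AddMonoidHom.mk' ψ hadd) (hφ.sub continuous_const) t v
  exact smul_left_injective ℝ (sub_ne_zero.mpr hv : ψ v ≠ 0) (hsmul.symm.trans (hleft v))

end Alexander

/-- There are infinitely many pairwise nonisomorphic nontrivial topological quandle
structures on the open unit ball `B°` of `ℝⁿ`, `n ≥ 1`. -/
theorem stmt12 (n : ℕ) (hn : 1 ≤ n) :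
    ∃ Ω : ℕ → (Metric.ball (0 : EuclideanSpace ℝ (Fin n)) 1 →
        Metric.ball (0 : EuclideanSpace ℝ (Fin n)) 1 →
        Metric.ball (0 : EuclideanSpace ℝ (Fin n)) 1),
      (∀ m, IsTopQuandleOp (Ω m) ∧ ∃ x₀ y₀, Ω m x₀ y₀ ≠ x₀) ∧
      (∀ m k, m ≠ k →
        ¬∃ φ : Metric.ball (0 : EuclideanSpace ℝ (Fin n)) 1 ≃ₜ
            Metric.ball (0 : EuclideanSpace ℝ (Fin n)) 1,
          ∀ x y, φ (Ω m x y) = Ω k (φ x) (φ y)) := by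
  have : Nonempty (Fin n) := ⟨⟨0, hn⟩⟩
  obtain ⟨v, hv⟩ := exists_ne (0 : EuclideanSpace ℝ (Fin n))
  let e : EuclideanSpace ℝ (Fin n) ≃ₜ Metric.ball (0 : EuclideanSpace ℝ (Fin n)) 1 :=
    Homeomorph.unitBall
  have ht : ∀ m : ℕ, (m + 2 : ℝ) ≠ 0 := fun m => by positivity
  have ht1 : ∀ m : ℕ, (m + 2 : ℝ) ≠ 1 := fun m => by
    have : (0 : ℝ) ≤ m := m.cast_nonneg
    linarith
  refine ⟨fun m => transportOp e (alexanderOp (m + 2 : ℝ)), fun m =>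
    ⟨(isTopQuandleOp_alexanderOp (ht m)).transportOp e, e v, e 0, fun h => ?_⟩, ?_⟩
  · have h' : (m + 2 : ℝ) • v = (1 : ℝ) • v := by
      simpa [transportOp, alexanderOp] using h
    exact ht1 m (smul_left_injective ℝ hv h')
  · rintro m k hmk ⟨φ, hφ⟩
    let ψ : EuclideanSpace ℝ (Fin n) ≃ₜ EuclideanSpace ℝ (Fin n) := (e.trans φ).trans e.symm
    have hψ : ∀ x y, ψ (alexanderOp (m + 2 : ℝ) x y) = alexanderOp (k + 2 : ℝ) (ψ x) (ψ y) :=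
      fun x y => by
        have := congrArg e.symm (hφ (e x) (e y))
        simpa [transportOp, ψ] using this
    have hmk' := alexanderOp_param_eq (ht m) (ht1 m) ψ.continuous (ψ.injective.ne hv) hψ
    exact hmk (by exact_mod_cast add_right_cancel hmk')
end

section
/- There exists a nontrivial topological quandle operation G on the real line ℝ such that G(x,y) = x for all x, y < 0, i.e., the negative half-line (−∞,0) is a trivial subquandle of (ℝ, G). -/
open Set

/-- The map of the line which is the identity on `[0, ∞)` and scales `(-∞, 0]` by `a`. -/
noncomputable def scaleNeg (a x : ℝ) : ℝ := max x 0 + min x 0 * a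

lemma max_scaleNeg {a : ℝ} (ha : 0 < a) (x : ℝ) : max (scaleNeg a x) 0 = max x 0 := by
  rcases le_total x 0 with h | h
  · simp [scaleNeg, h, mul_nonpos_of_nonpos_of_nonneg h ha.le]
  · simp [scaleNeg, h]

lemma min_scaleNeg {a : ℝ} (ha : 0 < a) (x : ℝ) : min (scaleNeg a x) 0 = min x 0 * a := by
  rcases le_total x 0 with h | h
  · simp [scaleNeg, h, mul_nonpos_of_nonpos_of_nonneg h ha.le]
  · simp [scaleNeg, h]

lemma scaleNeg_one (x : ℝ) : scaleNeg 1 x = x := by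
  simp [scaleNeg, max_add_min]

lemma scaleNeg_scaleNeg {a : ℝ} (ha : 0 < a) (b x : ℝ) :
    scaleNeg b (scaleNeg a x) = scaleNeg (a * b) x := by
  rw [scaleNeg, max_scaleNeg ha, min_scaleNeg ha, scaleNeg, mul_assoc]

lemma continuous_scaleNeg (a : ℝ) : Continuous (scaleNeg a) := by
  unfold scaleNeg
  fun_prop

/-- For `a > 0`, scaling the negative half-line by `a` is a homeomorphism of the line. -/
noncomputable def scaleNegHomeomorph (a : ℝ) (ha : 0 < a) : ℝ ≃ₜ ℝ where
  toFun := scaleNeg a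
  invFun := scaleNeg a⁻¹
  left_inv x := by rw [scaleNeg_scaleNeg ha, mul_inv_cancel₀ ha.ne', scaleNeg_one]
  right_inv x := by
    rw [scaleNeg_scaleNeg (inv_pos.2 ha), inv_mul_cancel₀ ha.ne', scaleNeg_one]
  continuous_toFun := continuous_scaleNeg a
  continuous_invFun := continuous_scaleNeg a⁻¹

/-- There is a nontrivial topological quandle operation on the real line for which the
negative half-line `(-∞, 0)` is a trivial subquandle. -/
theorem stmt14 :
    ∃ G : ℝ → ℝ → ℝ, IsTopQuandleOp G ∧ (∃ x₀ y₀, G x₀ y₀ ≠ x₀) ∧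
      (∀ x < (0 : ℝ), ∀ y < (0 : ℝ), G x y = x) := by
  have hpos (y : ℝ) : 0 < 1 + max y 0 := by positivity
  refine ⟨fun x y => scaleNeg (1 + max y 0) x, ⟨?_, fun x => ?_, fun x y z => ?_, fun y =>
    ⟨scaleNegHomeomorph _ (hpos y), fun _ => rfl⟩⟩, ⟨-1, 1, by norm_num [scaleNeg]⟩,
    fun x _ y hy => ?_⟩
  · unfold scaleNeg
    fun_prop
  · rcases le_total x 0 with h | h <;> simp [scaleNeg, h]
  · simp only [max_scaleNeg (hpos z), scaleNeg_scaleNeg (hpos _)]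
    rw [mul_comm]
  · simp only [max_eq_right hy.le, add_zero, scaleNeg_one]
end

section
/- There exists a nontrivial topological quandle operation G on the real line ℝ that is not isomorphic to any affine quandle (ℝ, f_t) with t ∉ {0,1}: for every real number t with t ≠ 0 and t ≠ 1, there is no homeomorphism φ : ℝ → ℝ satisfying φ(G(x,y)) = t·φ(x) + (1−t)·φ(y) for all x, y ∈ ℝ. (One may take G to be any nontrivial topological quandle operation on ℝ admitting a trivial subquandle with more than one point, since for t ∉ {0,1} the affine quandle f_t(x,y) = tx + (1−t)y has no such trivial subquandle.) -/
open Set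

/-- The operation fixing the nonpositive half-line pointwise and scaling the nonnegative
half-line by the factor `1 + y⁻`, where `y⁻` is the negative part of `y`. -/
def halfLineScaling (x y : ℝ) : ℝ := min x 0 + max x 0 * (1 + max (-y) 0)

theorem halfLineScaling_of_nonpos {x : ℝ} (hx : x ≤ 0) (y : ℝ) :
    halfLineScaling x y = x := by
  simp [halfLineScaling, hx]

theorem halfLineScaling_of_nonneg {x : ℝ} (hx : 0 ≤ x) (y : ℝ) :
    halfLineScaling x y = x * (1 + max (-y) 0) := by
  simp [halfLineScaling, hx]

theorem halfLineScaling_nonneg {x : ℝ} (hx : 0 ≤ x) (y : ℝ) : 0 ≤ halfLineScaling x y := by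
  rw [halfLineScaling_of_nonneg hx]
  positivity

theorem halfLineScaling_of_nonneg_right (x : ℝ) {y : ℝ} (hy : 0 ≤ y) :
    halfLineScaling x y = x := by
  simp [halfLineScaling, hy]

theorem halfLineScaling_right_invariant (x y z : ℝ) :
    halfLineScaling x (halfLineScaling y z) = halfLineScaling x y := by
  rcases le_total y 0 with hy | hy
  · rw [halfLineScaling_of_nonpos hy]
  · rw [halfLineScaling_of_nonneg_right x hy,
      halfLineScaling_of_nonneg_right x (halfLineScaling_nonneg hy z)]

theorem halfLineScaling_right_comm (x y z : ℝ) :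
    halfLineScaling (halfLineScaling x y) z = halfLineScaling (halfLineScaling x z) y := by
  rcases le_total x 0 with hx | hx
  · simp only [halfLineScaling_of_nonpos hx]
  · rw [halfLineScaling_of_nonneg (halfLineScaling_nonneg hx y),
      halfLineScaling_of_nonneg (halfLineScaling_nonneg hx z),
      halfLineScaling_of_nonneg hx, halfLineScaling_of_nonneg hx]
    ring

/-- Scaling the nonnegative half-line by a positive factor, as a homeomorphism of `ℝ`. -/
noncomputable def halfLineHomeomorph (c : ℝ) (hc : 0 < c) : ℝ ≃ₜ ℝ where
  toFun x := min x 0 + max x 0 * c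
  invFun x := min x 0 + max x 0 * c⁻¹
  left_inv x := by
    rcases le_total x 0 with hx | hx
    · simp [hx]
    · have : 0 ≤ x * c := by positivity
      simp [hx, this, hc.ne']
  right_inv x := by
    rcases le_total x 0 with hx | hx
    · simp [hx]
    · have : 0 ≤ x * c⁻¹ := by positivity
      simp [hx, this, hc.ne']
  continuous_toFun := by fun_prop
  continuous_invFun := by fun_prop

theorem isTopQuandleOp_halfLineScaling : IsTopQuandleOp halfLineScaling := by
  refine ⟨?_, fun x => ?_, fun x y z => ?_, fun y => ?_⟩
  · unfold halfLineScaling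
    fun_prop
  · rcases le_total x 0 with hx | hx
    · exact halfLineScaling_of_nonpos hx x
    · exact halfLineScaling_of_nonneg_right x hx
  · rw [halfLineScaling_right_invariant, halfLineScaling_right_comm]
  · exact ⟨halfLineHomeomorph (1 + max (-y) 0) (by positivity), fun _ => rfl⟩

/-- For `t ≠ 1`, a quandle with two distinct points `a`, `b` such that `a` is fixed by the
right translation by `b` does not embed into the affine quandle with parameter `t`. -/
theorem not_affine_of_fixed {X : Type*} {f : X → X → X} {a b : X} (hab : a ≠ b)
    (hf : f a b = a) {t : ℝ} (ht : t ≠ 1) {φ : X → ℝ} (hφ : Function.Injective φ) :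
    ¬∀ x y, φ (f x y) = t * φ x + (1 - t) * φ y := by
  intro h
  have key := h a b
  rw [hf] at key
  have hmul : (1 - t) * (φ a - φ b) = 0 := by linear_combination key
  rcases mul_eq_zero.mp hmul with h₁ | h₁
  · exact ht (sub_eq_zero.mp h₁).symm
  · exact hab (hφ (sub_eq_zero.mp h₁))

/-- There is a nontrivial topological quandle operation on the real line which is not
isomorphic to any affine quandle `(ℝ, f_t)`, `f_t(x,y) = t·x + (1-t)·y`, with
`t ∉ {0,1}`. -/
theorem stmt15 :
    ∃ G : ℝ → ℝ → ℝ, IsTopQuandleOp G ∧ (∃ x₀ y₀, G x₀ y₀ ≠ x₀) ∧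
      ∀ t : ℝ, t ≠ 0 → t ≠ 1 →
        ¬∃ φ : ℝ ≃ₜ ℝ, ∀ x y, φ (G x y) = t * φ x + (1 - t) * φ y := by
  refine ⟨halfLineScaling, isTopQuandleOp_halfLineScaling, ⟨1, -1, ?_⟩, ?_⟩
  · norm_num [halfLineScaling]
  · rintro t - ht ⟨φ, hφ⟩
    exact not_affine_of_fixed (a := (-1 : ℝ)) (b := -2) (by norm_num)
      (halfLineScaling_of_nonpos (by norm_num) _) ht φ.injective hφ
end

section
/- Let f : [0,1] × [0,1] → [0,1] be continuous with f(x,x) = x for all x ∈ [0,1], and suppose that for each y ∈ [0,1] the right translation R_y : x ↦ f(x,y) is a homeomorphism of [0,1]. Then f(0,y) = 0 and f(1,y) = 1 for all y ∈ [0,1]; that is, every right translation R_y is an orientation-preserving homeomorphism of [0,1] (it fixes both endpoints). Consequently, for any topological quandle operation on [0,1] the endpoints 0 and 1 are singleton orbits. -/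
open Set

/-- A homeomorphism of `[0,1]` either fixes both endpoints or swaps them. -/
theorem Homeomorph.unitInterval_endpoints (h : unitInterval ≃ₜ unitInterval) :
    (h 0 = 0 ∧ h 1 = 1) ∨ (h 0 = 1 ∧ h 1 = 0) := by
  rcases h.continuous.strictMono_of_inj h.injective with hm | hm
  · let e := hm.orderIsoOfSurjective h h.surjective
    exact Or.inl ⟨e.map_bot, e.map_top⟩
  · obtain ⟨a, ha⟩ := h.surjective 0
    obtain ⟨b, hb⟩ := h.surjective 1
    refine Or.inr ⟨le_antisymm unitInterval.le_one' ?_, le_antisymm ?_ unitInterval.nonneg'⟩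
    · exact hb ▸ hm.antitone unitInterval.nonneg'
    · exact ha ▸ hm.antitone unitInterval.le_one'

/-- A continuous self-map of `[0,1]` taking only the values `0` and `1` is constant. -/
theorem Continuous.eq_of_unitInterval_endpoints {g : unitInterval → unitInterval}
    (hg : Continuous g) (h01 : ∀ y, g y = 0 ∨ g y = 1) (a b : unitInterval) : g a = g b := by
  have hlt : ∀ a b, ¬(g a = 0 ∧ g b = 1) := by
    rintro a b ⟨ha, hb⟩
    obtain ⟨c, hc⟩ : (⟨1 / 2, by norm_num, by norm_num⟩ : unitInterval) ∈ range g :=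
      mem_range_of_exists_le_of_exists_ge hg
        ⟨a, ha ▸ unitInterval.nonneg'⟩ ⟨b, hb ▸ unitInterval.le_one'⟩
    have hc' := congrArg Subtype.val hc
    rcases h01 c with h | h <;> rw [h] at hc' <;> norm_num at hc'
  rcases h01 a with ha | ha <;> rcases h01 b with hb | hb
  · rw [ha, hb]
  · exact (hlt a b ⟨ha, hb⟩).elim
  · exact (hlt b a ⟨hb, ha⟩).elim
  · rw [ha, hb]

/-- If `f` is a continuous idempotent binary operation on `[0,1]` whose right
translations are homeomorphisms (e.g. a topological quandle operation), then every
right translation fixes both endpoints: `f 0 y = 0` and `f 1 y = 1` for all `y`.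
In particular the endpoints `0` and `1` are singleton orbits. -/
theorem stmt16 (f : unitInterval → unitInterval → unitInterval)
    (hcont : Continuous fun p : unitInterval × unitInterval => f p.1 p.2)
    (hidem : ∀ x, f x x = x)
    (hhomeo : ∀ y, ∃ h : unitInterval ≃ₜ unitInterval, ∀ x, h x = f x y) :
    ∀ y, f 0 y = 0 ∧ f 1 y = 1 := by
  have h0 : ∀ y, f 0 y = 0 ∨ f 0 y = 1 := fun y ↦ by
    obtain ⟨h, hh⟩ := hhomeo y
    rw [← hh]
    exact h.unitInterval_endpoints.imp And.left And.left
  have h1 : ∀ y, f 1 y = 0 ∨ f 1 y = 1 := fun y ↦ by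
    obtain ⟨h, hh⟩ := hhomeo y
    rw [← hh]
    exact (h.unitInterval_endpoints.imp And.right And.right).symm
  have hslice : ∀ x, Continuous (f x) := fun x ↦
    hcont.comp (Continuous.prodMk_right x)
  exact fun y ↦ ⟨((hslice 0).eq_of_unitInterval_endpoints h0 y 0).trans (hidem 0),
    ((hslice 1).eq_of_unitInterval_endpoints h1 y 1).trans (hidem 1)⟩
end

section
/- There are no nontrivial quandle structures on [0,1] given by a polynomial: if p is a real polynomial in two variables such that p maps [0,1] × [0,1] into [0,1], p(x,x) = x for all x ∈ [0,1], p(p(x,y),z) = p(p(x,z),p(y,z)) for all x, y, z ∈ [0,1], and for each y ∈ [0,1] the map x ↦ p(x,y) is a bijection of [0,1] onto itself, then p(x,y) = x for all (x,y) ∈ [0,1] × [0,1]. -/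
open Set

/-- A bivariate polynomial, regarded as a polynomial in its second variable whose coefficients
are polynomials in the first. -/
noncomputable def toIterated (p : MvPolynomial (Fin 2) ℝ) : Polynomial (Polynomial ℝ) :=
  MvPolynomial.eval₂ (Polynomial.C.comp Polynomial.C) ![Polynomial.C Polynomial.X, Polynomial.X] p

theorem eval_map_toIterated (p : MvPolynomial (Fin 2) ℝ) (x y : ℝ) :
    ((toIterated p).map (Polynomial.evalRingHom x)).eval y = MvPolynomial.eval ![x, y] p := by
  induction p using MvPolynomial.induction_on with
  | C a => simp [toIterated]
  | add p q hp hq => simp_all [toIterated]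
  | mul_X p i hp =>
    fin_cases i <;> simp_all [toIterated]

/-- The rescaled values `t ^ n * p (x, 1 / t)`, with `n` the degree of `p` in its second variable,
extend to a polynomial in `t` whose value at `0` is the leading coefficient. -/
theorem exists_rescaled_polynomial (p : MvPolynomial (Fin 2) ℝ) (x : ℝ) :
    ∃ r : Polynomial ℝ, r.eval 0 = (toIterated p).leadingCoeff.eval x ∧
      ∀ t : ℝ, t ≠ 0 →
        MvPolynomial.eval ![x, t⁻¹] p * t ^ (toIterated p).natDegree = r.eval t := by
  set q := toIterated p with hq
  refine ⟨((q.map (Polynomial.evalRingHom x)).reflect q.natDegree), ?_, ?_⟩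
  · rw [← Polynomial.coeff_zero_eq_eval_zero, Polynomial.coeff_reflect]
    simp [Polynomial.revAt_le]
  · intro t ht
    rw [← eval_map_toIterated, ← hq]
    let _ : Invertible t⁻¹ := invertibleOfNonzero (inv_ne_zero ht)
    have h := Polynomial.eval₂_reflect_mul_pow (RingHom.id ℝ) t⁻¹ q.natDegree
      (q.map (Polynomial.evalRingHom x)) Polynomial.natDegree_map_le
    rw [invOf_eq_inv, inv_inv, Polynomial.eval₂_id, Polynomial.eval₂_id] at h
    rw [← h, mul_assoc, ← mul_pow, inv_mul_cancel₀ ht, one_pow, mul_one]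

/-- The value at `(a, b, τ)` of the homogenization of a bivariate polynomial. -/
noncomputable def homogenization (p : MvPolynomial (Fin 2) ℝ) (a b τ : ℝ) : ℝ :=
  ∑ s ∈ p.support, p.coeff s * (a ^ s 0 * b ^ s 1) * τ ^ (p.totalDegree - (s 0 + s 1))

theorem eval_eq_sum (p : MvPolynomial (Fin 2) ℝ) (x y : ℝ) :
    MvPolynomial.eval ![x, y] p = ∑ s ∈ p.support, p.coeff s * (x ^ s 0 * y ^ s 1) := by
  rw [MvPolynomial.eval_eq']
  simp [Fin.prod_univ_two]

theorem add_le_totalDegree {p : MvPolynomial (Fin 2) ℝ} {s : Fin 2 →₀ ℕ} (hs : s ∈ p.support) :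
    s 0 + s 1 ≤ p.totalDegree := by
  have h := MvPolynomial.le_totalDegree hs
  rwa [Finsupp.sum_fintype _ _ (by simp), Fin.sum_univ_two] at h

theorem homogenization_mul (p : MvPolynomial (Fin 2) ℝ) (u v τ : ℝ) :
    homogenization p (u * τ) (v * τ) τ = MvPolynomial.eval ![u, v] p * τ ^ p.totalDegree := by
  rw [homogenization, eval_eq_sum, Finset.sum_mul]
  refine Finset.sum_congr rfl fun s hs => ?_
  rw [← Nat.add_sub_cancel' (add_le_totalDegree hs), pow_add, pow_add, mul_pow, mul_pow,
    Nat.add_sub_cancel_left]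
  ring

theorem homogenization_zero (p : MvPolynomial (Fin 2) ℝ) (a b : ℝ) :
    homogenization p a b 0 =
      MvPolynomial.eval ![a, b] (MvPolynomial.homogeneousComponent p.totalDegree p) := by
  rw [homogenization, MvPolynomial.homogeneousComponent_apply, map_sum, Finset.sum_filter]
  refine Finset.sum_congr rfl fun s hs => ?_
  have h := add_le_totalDegree hs
  have hd : s.degree = s 0 + s 1 := by
    rw [Finsupp.degree_eq_sum, Fin.sum_univ_two]
  rw [hd, MvPolynomial.eval_monomial, Finsupp.prod_fintype _ _ (by simp), Fin.prod_univ_two]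
  split_ifs with h'
  · simp [h']
  · rw [zero_pow (by omega)]; simp

theorem eq_of_forall_ne_zero {f g : ℝ → ℝ} (hf : Continuous f) (hg : Continuous g)
    (h : ∀ t, t ≠ 0 → f t = g t) : f 0 = g 0 :=
  congrFun (hf.ext_on (dense_compl_singleton 0) hg fun t ht => h t ht) 0

/-- A polynomial satisfying the self-distributive law on `[0,1]` satisfies it everywhere. -/
theorem selfDistrib_of_Icc {p : MvPolynomial (Fin 2) ℝ} {P : ℝ → ℝ → ℝ}
    (hP : ∀ x y, P x y = MvPolynomial.eval ![x, y] p)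
    (hdist : ∀ x ∈ Icc (0 : ℝ) 1, ∀ y ∈ Icc (0 : ℝ) 1, ∀ z ∈ Icc (0 : ℝ) 1,
      P (P x y) z = P (P x z) (P y z)) (x y z : ℝ) :
    P (P x y) z = P (P x z) (P y z) := by
  have key (v : Fin 3 → ℝ) (f g : MvPolynomial (Fin 3) ℝ) :
      MvPolynomial.eval v (MvPolynomial.bind₁ ![f, g] p) =
        P (MvPolynomial.eval v f) (MvPolynomial.eval v g) := by
    rw [hP, ← MvPolynomial.coe_aeval_eq_eval,
      AlgHom.coe_toRingHom, MvPolynomial.aeval_bind₁, MvPolynomial.aeval_def,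
      Algebra.algebraMap_self, MvPolynomial.eval₂_id]
    congr 2
    funext i
    fin_cases i <;> simp
  let X : Fin 3 → MvPolynomial (Fin 3) ℝ := MvPolynomial.X
  have h := MvPolynomial.funext_set (fun _ : Fin 3 => Icc (0 : ℝ) 1)
    (fun _ => Icc_infinite one_pos)
    (p := MvPolynomial.bind₁ ![MvPolynomial.bind₁ ![X 0, X 1] p, X 2] p)
    (q := MvPolynomial.bind₁
      ![MvPolynomial.bind₁ ![X 0, X 2] p, MvPolynomial.bind₁ ![X 1, X 2] p] p) (by
      intro v hv
      simp only [key, X, MvPolynomial.eval_X]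
      exact hdist _ (hv 0 trivial) _ (hv 1 trivial) _ (hv 2 trivial))
  simpa [key, X] using congrArg (MvPolynomial.eval ![x, y, z]) h

theorem infinite_range_eval {b : Polynomial ℝ} (hb : 0 < b.degree) :
    (range fun x => b.eval x).Infinite := by
  intro hfin
  have h := hfin.preimage' (f := fun x => b.eval x) fun c _ => by
    have hne : b - Polynomial.C c ≠ 0 := fun h0 => by
      rw [sub_eq_zero.mp h0] at hb
      exact absurd hb (not_lt.mpr Polynomial.degree_C_le)
    refine (Polynomial.finite_setOfPred_isRoot hne).subset fun x hx => ?_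
    have hx' : b.eval x = c := hx
    simp [Polynomial.IsRoot, hx']
  rw [preimage_range] at h
  exact infinite_univ h

/-- If a self-distributive polynomial has nonconstant leading coefficient in its second variable,
then its degree is at most one. -/
theorem totalDegree_le_one_of_selfDistrib {p : MvPolynomial (Fin 2) ℝ} {P : ℝ → ℝ → ℝ}
    (hP : ∀ x y, P x y = MvPolynomial.eval ![x, y] p)
    (hdist : ∀ x y z, P (P x y) z = P (P x z) (P y z))
    (hn : 0 < (toIterated p).natDegree) (hb : 0 < (toIterated p).leadingCoeff.degree) :
    p.totalDegree ≤ 1 := by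
  by_contra! hd
  set n := (toIterated p).natDegree
  set d := p.totalDegree
  set b := (toIterated p).leadingCoeff
  have hzero (x y : ℝ) : MvPolynomial.eval ![b.eval x, b.eval y]
      (MvPolynomial.homogeneousComponent d p) = 0 := by
    obtain ⟨rx, hx0, hx⟩ := exists_rescaled_polynomial p x
    obtain ⟨ry, hy0, hy⟩ := exists_rescaled_polynomial p y
    obtain ⟨rz, -, hw⟩ := exists_rescaled_polynomial p (P x y)
    have h := eq_of_forall_ne_zero
      (f := fun t => homogenization p (rx.eval t) (ry.eval t) (t ^ n))
      (g := fun t => rz.eval t * (t ^ n) ^ (d - 1))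
      (by unfold homogenization; fun_prop) (by fun_prop) (by
        intro t ht
        rw [← hx t ht, ← hy t ht, ← hw t ht, homogenization_mul, ← hP, ← hP, ← hP, ← hP, ← hdist,
          mul_assoc, ← pow_succ', Nat.sub_add_cancel hd.le])
    simp only [zero_pow hn.ne', zero_pow (Nat.sub_pos_of_lt hd).ne', mul_zero,
      homogenization_zero, hx0, hy0] at h
    exact h
  have hcomp : MvPolynomial.homogeneousComponent d p = 0 :=
    MvPolynomial.funext_set (fun _ : Fin 2 => range fun x => b.eval x)
      (fun _ => infinite_range_eval hb) (by
        intro v hv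
        obtain ⟨x, hx⟩ := hv 0 trivial
        obtain ⟨y, hy⟩ := hv 1 trivial
        have hv' : v = ![b.eval x, b.eval y] := by
          funext i
          fin_cases i
          · exact hx.symm
          · exact hy.symm
        rw [hv', hzero, map_zero])
  have hp : p ≠ 0 := by
    rintro rfl
    simp [d] at hd
  obtain ⟨s, hs, hsd⟩ := Finset.exists_mem_eq_sup p.support (MvPolynomial.support_nonempty.mpr hp)
    fun s => s.sum fun _ e => e
  have hcoeff := congrArg (MvPolynomial.coeff s) hcomp
  rw [MvPolynomial.coeff_homogeneousComponent, if_pos (show s.degree = d from hsd.symm),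
    MvPolynomial.coeff_zero] at hcoeff
  exact MvPolynomial.mem_support_iff.mp hs hcoeff

/-- The mixed second difference of a polynomial of degree at most one vanishes. -/
theorem eval_add_eval_of_totalDegree_le_one {p : MvPolynomial (Fin 2) ℝ}
    (hd : p.totalDegree ≤ 1) (x y : ℝ) :
    MvPolynomial.eval ![x, y] p + MvPolynomial.eval ![0, 0] p =
      MvPolynomial.eval ![x, 0] p + MvPolynomial.eval ![0, y] p := by
  simp only [eval_eq_sum, ← Finset.sum_add_distrib]
  refine Finset.sum_congr rfl fun s hs => ?_
  have h := (add_le_totalDegree hs).trans hd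
  obtain h0 | h1 : s 0 = 0 ∨ s 1 = 0 := by omega
  · rw [h0]; ring
  · rw [h1]; ring

/-- If every right translation is a bijection of `[0,1]`, then `0` is fixed by all of them. -/
theorem apply_zero_eq_zero_of_bijOn {P : ℝ → ℝ → ℝ} (hP : Continuous fun v : ℝ × ℝ => P v.1 v.2)
    (h00 : P 0 0 = 0)
    (hbij : ∀ y ∈ Icc (0 : ℝ) 1, Set.BijOn (fun x => P x y) (Icc 0 1) (Icc 0 1)) :
    ∀ y ∈ Icc (0 : ℝ) 1, P 0 y = 0 := by
  have h0 : (0 : ℝ) ∈ Icc (0 : ℝ) 1 := ⟨le_rfl, zero_le_one⟩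
  have h1 : (1 : ℝ) ∈ Icc (0 : ℝ) 1 := ⟨zero_le_one, le_rfl⟩
  have hends (y : ℝ) (hy : y ∈ Icc (0 : ℝ) 1) : P 0 y = 0 ∨ P 0 y = 1 := by
    have hc : Continuous fun x => P x y := hP.comp (by fun_prop : Continuous fun x : ℝ => (x, y))
    have hm := (hbij y hy).mapsTo h0
    rcases hc.continuousOn.strictMonoOn_of_injOn_Icc' zero_le_one (hbij y hy).injOn with h | h
    · obtain ⟨x, hx, hxy⟩ := (hbij y hy).surjOn h0
      exact .inl (le_antisymm (hxy ▸ h.monotoneOn h0 hx hx.1) hm.1)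
    · obtain ⟨x, hx, hxy⟩ := (hbij y hy).surjOn h1
      exact .inr (le_antisymm hm.2 (hxy ▸ h.antitoneOn h0 hx hx.1))
  intro y hy
  refine (hends y hy).resolve_right fun hy1 => ?_
  have hc : Continuous fun y => P 0 y :=
    hP.comp (by fun_prop : Continuous fun y : ℝ => ((0 : ℝ), y))
  obtain ⟨w, hw, hw2⟩ := intermediate_value_Icc hy.1 hc.continuousOn
    (show (1 / 2 : ℝ) ∈ Icc (P 0 0) (P 0 y) by rw [h00, hy1]; norm_num)
  have hw2' : P 0 w = 1 / 2 := hw2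
  rcases hends w ⟨hw.1, hw.2.trans hy.2⟩ with h | h <;> norm_num [hw2'] at h

/-- There is no nontrivial quandle structure on `[0,1]` given by a polynomial: if a real
polynomial `p` in two variables maps `[0,1]²` into `[0,1]`, is idempotent and right
self-distributive on `[0,1]`, and each of its right translations is a bijection of
`[0,1]`, then `p(x,y) = x` on `[0,1]²`. -/
theorem stmt17 (p : MvPolynomial (Fin 2) ℝ) (P : ℝ → ℝ → ℝ)
    (hP : ∀ x y, P x y = MvPolynomial.eval ![x, y] p)
    (hmaps : ∀ x ∈ Icc (0 : ℝ) 1, ∀ y ∈ Icc (0 : ℝ) 1, P x y ∈ Icc (0 : ℝ) 1)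
    (hidem : ∀ x ∈ Icc (0 : ℝ) 1, P x x = x)
    (hdist : ∀ x ∈ Icc (0 : ℝ) 1, ∀ y ∈ Icc (0 : ℝ) 1, ∀ z ∈ Icc (0 : ℝ) 1,
      P (P x y) z = P (P x z) (P y z))
    (hbij : ∀ y ∈ Icc (0 : ℝ) 1, Set.BijOn (fun x => P x y) (Icc 0 1) (Icc 0 1)) :
    ∀ x ∈ Icc (0 : ℝ) 1, ∀ y ∈ Icc (0 : ℝ) 1, P x y = x := by
  have h0 : (0 : ℝ) ∈ Icc (0 : ℝ) 1 := ⟨le_rfl, zero_le_one⟩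
  have hcont : Continuous fun v : ℝ × ℝ => P v.1 v.2 := by
    simp only [hP, eval_eq_sum]
    fun_prop
  have hzero := apply_zero_eq_zero_of_bijOn hcont (hidem 0 h0) hbij
  intro x hx y hy
  suffices h : P x y = P x x from h.trans (hidem x hx)
  rcases Nat.eq_zero_or_pos (toIterated p).natDegree with hn | hn
  · rw [hP, hP, ← eval_map_toIterated, ← eval_map_toIterated,
      Polynomial.eq_C_of_natDegree_eq_zero hn]
    simp
  have hlead : (toIterated p).leadingCoeff.eval 0 = 0 := by
    have hmap : (toIterated p).map (Polynomial.evalRingHom 0) = 0 := by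
      refine Polynomial.eq_zero_of_infinite_isRoot _ ((Icc_infinite one_pos).mono fun z hz => ?_)
      exact (eval_map_toIterated p 0 z).trans ((hP 0 z).symm.trans (hzero z hz))
    simpa using congrArg (Polynomial.coeff · (toIterated p).natDegree) hmap
  have hb : 0 < (toIterated p).leadingCoeff.degree := by
    refine Polynomial.degree_pos_of_root ?_ hlead
    exact Polynomial.leadingCoeff_ne_zero.mpr (Polynomial.ne_zero_of_natDegree_gt hn)
  have hd := totalDegree_le_one_of_selfDistrib hP (selfDistrib_of_Icc hP hdist) hn hb
  have hconst (z : ℝ) (hz : z ∈ Icc (0 : ℝ) 1) : P x z = P x 0 := by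
    have h := eval_add_eval_of_totalDegree_le_one hd x z
    rw [← hP, ← hP, ← hP, ← hP, hzero z hz, hzero 0 h0] at h
    linarith
  rw [hconst y hy, hconst x hx]
end

section
/- Every rack structure on [0,1] given by a polynomial is independent of the second variable: if p is a real polynomial in two variables such that p maps [0,1] × [0,1] into [0,1], p(p(x,y),z) = p(p(x,z),p(y,z)) for all x, y, z ∈ [0,1], and for each y ∈ [0,1] the map x ↦ p(x,y) is a homeomorphism of [0,1] fixing the endpoints (p(0,y) = 0 and p(1,y) = 1), then p(x,y) = p(x,y′) for all x, y, y′ ∈ [0,1]; i.e., on [0,1] × [0,1] the function p is a polynomial in the single variable x, invertible as a map [0,1] → [0,1]. -/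
open Set

/-- If `A` and `B` have degree at most `e` and `p` has total degree at most `D`, the coefficient of
degree `D * e` of `p(A, B)` is the degree `D` form of `p` at the degree `e` coefficients. -/
theorem coeff_aeval_pair_mul {p : MvPolynomial (Fin 2) ℝ} {A B : Polynomial ℝ} {e D : ℕ}
    (he : 0 < e) (hA : A.natDegree ≤ e) (hB : B.natDegree ≤ e) (hD : p.totalDegree ≤ D) :
    (MvPolynomial.aeval ![A, B] p).coeff (D * e) =
      MvPolynomial.eval ![A.coeff e, B.coeff e] (MvPolynomial.homogeneousComponent D p) := by
  rw [MvPolynomial.homogeneousComponent_apply, map_sum, MvPolynomial.aeval_def,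
    MvPolynomial.eval₂_eq', Polynomial.finsetSum_coeff, Finset.sum_filter]
  refine Finset.sum_congr rfl fun m hm => ?_
  have hdeg : m.degree = m 0 + m 1 := by simp [Finsupp.degree_eq_sum]
  have hle : m 0 + m 1 ≤ D := by
    rw [← hdeg]
    exact (MvPolynomial.le_totalDegree hm).trans hD
  have hA' : (A ^ m 0).natDegree ≤ m 0 * e := Polynomial.natDegree_pow_le_of_le _ hA
  have hB' : (B ^ m 1).natDegree ≤ m 1 * e := Polynomial.natDegree_pow_le_of_le _ hB
  simp only [Fin.prod_univ_two, Matrix.cons_val_zero, Matrix.cons_val_one,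
    Polynomial.algebraMap_eq, Polynomial.coeff_C_mul, MvPolynomial.eval_monomial,
    Finsupp.prod_fintype _ _ (fun _ => pow_zero _), hdeg]
  split_ifs with h
  · rw [← h, add_mul, Polynomial.coeff_mul_add_eq_of_natDegree_le hA' hB',
      Polynomial.coeff_pow_of_natDegree_le hA, Polynomial.coeff_pow_of_natDegree_le hB]
  · have hlt : (m 0 + m 1) * e < D * e := Nat.mul_lt_mul_of_pos_right (lt_of_le_of_ne hle h) he
    rw [Polynomial.coeff_eq_zero_of_natDegree_lt, mul_zero]
    exact (Polynomial.natDegree_mul_le_of_le hA' hB').trans_lt (by rwa [← add_mul])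

/-- A polynomial in two variables of total degree at most one is the sum of its restrictions
to the axes, up to its constant term. -/
theorem eval_pair_add_eval_zero {p : MvPolynomial (Fin 2) ℝ} (hp : p.totalDegree ≤ 1) (x y : ℝ) :
    MvPolynomial.eval ![x, y] p + MvPolynomial.eval ![0, 0] p =
      MvPolynomial.eval ![x, 0] p + MvPolynomial.eval ![0, y] p := by
  simp only [MvPolynomial.eval_eq', ← Finset.sum_add_distrib, ← mul_add]
  refine Finset.sum_congr rfl fun m hm => ?_
  have hle : m 0 + m 1 ≤ 1 := by
    have h : m.degree ≤ 1 := (MvPolynomial.le_totalDegree hm).trans hp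
    simpa [Finsupp.degree_eq_sum] using h
  congr 1
  simp only [Fin.prod_univ_two, Matrix.cons_val_zero, Matrix.cons_val_one]
  obtain h | h : m 0 = 0 ∨ m 1 = 0 := by omega
  · simp [h, add_comm]
  · simp [h]

/-- A nonconstant real polynomial takes infinitely many values on an infinite set. -/
theorem infinite_image_eval {c : Polynomial ℝ} (hc : ∀ a, c ≠ Polynomial.C a) {s : Set ℝ}
    (hs : s.Infinite) : ((fun x => c.eval x) '' s).Infinite := by
  intro hfin
  refine hs (Set.Finite.of_finite_fibers _ hfin fun a _ => ?_)
  refine (Polynomial.finite_setOfPred_isRoot (sub_ne_zero.mpr (hc a))).subset fun x hx => ?_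
  simpa [sub_eq_zero] using hx.2

/-- The restriction of `p` to a line of constant first coordinate, as a
specialization of `p` viewed in `ℝ[X][Y]`. -/
theorem aeval_C_X_eq_map (p : MvPolynomial (Fin 2) ℝ) (x : ℝ) :
    MvPolynomial.aeval ![Polynomial.C x, Polynomial.X] p =
      (MvPolynomial.aeval ![Polynomial.C Polynomial.X, Polynomial.X] p :
        Polynomial (Polynomial ℝ)).map (Polynomial.evalRingHom x) := by
  induction p using MvPolynomial.induction_on with
  | C a => simp
  | add p q hp hq => simp [hp, hq]
  | mul_X p i hp => fin_cases i <;> simp [hp]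

theorem eval_aeval_pair (p : MvPolynomial (Fin 2) ℝ) (A B : Polynomial ℝ) (z : ℝ) :
    (MvPolynomial.aeval ![A, B] p).eval z = MvPolynomial.eval ![A.eval z, B.eval z] p := by
  induction p using MvPolynomial.induction_on with
  | C a => simp
  | add p q hp hq => simp [hp, hq]
  | mul_X p i hp => fin_cases i <;> simp [hp]

/-- Every rack structure on `[0,1]` given by a polynomial is independent of the second
variable: if a real polynomial `p` in two variables maps `[0,1]²` into `[0,1]`, is right
self-distributive on `[0,1]`, and each right translation is a homeomorphism of `[0,1]`
fixing the endpoints, then `p(x,y)` does not depend on `y` on `[0,1]²`, i.e. it is a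
polynomial function of the single variable `x`, invertible as a map `[0,1] → [0,1]`. -/
theorem stmt18 (p : MvPolynomial (Fin 2) ℝ) (P : ℝ → ℝ → ℝ)
    (hP : ∀ x y, P x y = MvPolynomial.eval ![x, y] p)
    (hmaps : ∀ x ∈ Icc (0 : ℝ) 1, ∀ y ∈ Icc (0 : ℝ) 1, P x y ∈ Icc (0 : ℝ) 1)
    (hdist : ∀ x ∈ Icc (0 : ℝ) 1, ∀ y ∈ Icc (0 : ℝ) 1, ∀ z ∈ Icc (0 : ℝ) 1,
      P (P x y) z = P (P x z) (P y z))
    (hhomeo : ∀ y ∈ Icc (0 : ℝ) 1,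
      ∃ h : unitInterval ≃ₜ unitInterval, ∀ x : unitInterval, (h x : ℝ) = P x y)
    (hfix : ∀ y ∈ Icc (0 : ℝ) 1, P 0 y = 0 ∧ P 1 y = 1) :
    ∀ x ∈ Icc (0 : ℝ) 1, ∀ y ∈ Icc (0 : ℝ) 1, ∀ y' ∈ Icc (0 : ℝ) 1, P x y = P x y' := by
  have hinf : (Icc (0 : ℝ) 1).Infinite := Icc_infinite one_pos
  have h0 : (0 : ℝ) ∈ Icc (0 : ℝ) 1 := by simp
  rcases Nat.lt_or_ge 1 p.totalDegree with hD | hD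
  swap
  · have key : ∀ x, ∀ y ∈ Icc (0 : ℝ) 1, P x y = P x 0 := by
      intro x y hy
      have h := eval_pair_add_eval_zero hD x y
      simp only [← hP, (hfix 0 h0).1, (hfix y hy).1, add_zero] at h
      exact h
    intro x _ y hy y' hy'
    rw [key x y hy, key x y' hy']
  set A : ℝ → Polynomial ℝ := fun x => MvPolynomial.aeval ![Polynomial.C x, Polynomial.X] p
  set Q : Polynomial (Polynomial ℝ) :=
    MvPolynomial.aeval ![Polynomial.C Polynomial.X, Polynomial.X] p
  have hAQ : ∀ x, A x = Q.map (Polynomial.evalRingHom x) := aeval_C_X_eq_map p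
  have hAP : ∀ x z, (A x).eval z = P x z := fun x z => by
    simp [A, eval_aeval_pair, hP]
  have hAdeg : ∀ x, (A x).natDegree ≤ Q.natDegree := fun x => by
    rw [hAQ]
    exact Polynomial.natDegree_map_le
  have hAcoeff : ∀ x, (A x).coeff Q.natDegree = Q.leadingCoeff.eval x := fun x => by
    rw [hAQ, Polynomial.coeff_map]
    rfl
  rcases Nat.eq_zero_or_pos Q.natDegree with he | he
  · intro x _ y _ y' _
    rw [← hAP, ← hAP, Polynomial.eq_C_of_natDegree_le_zero ((hAdeg x).trans he.le)]
    simp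
  exfalso
  have hA0 : A 0 = 0 := Polynomial.eq_of_infinite_eval_eq _ _
    (hinf.mono fun z hz => by simp [hAP, (hfix z hz).1])
  have hc : ∀ a, Q.leadingCoeff ≠ Polynomial.C a := by
    intro a ha
    have h := hAcoeff 0
    rw [hA0, ha, Polynomial.eval_C, Polynomial.coeff_zero] at h
    rw [← h, Polynomial.C_0, Polynomial.leadingCoeff_eq_zero] at ha
    simp [ha] at he
  have htop : MvPolynomial.homogeneousComponent p.totalDegree p = 0 := by
    refine MvPolynomial.funext_set (fun _ => (fun x => Q.leadingCoeff.eval x) '' Icc (0 : ℝ) 1)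
      (fun _ => infinite_image_eval hc hinf) fun v hv => ?_
    obtain ⟨x, hx, hvx⟩ := hv 0 (mem_univ _)
    obtain ⟨y, hy, hvy⟩ := hv 1 (mem_univ _)
    have hid : A (P x y) = MvPolynomial.aeval ![A x, A y] p :=
      Polynomial.eq_of_infinite_eval_eq _ _ (hinf.mono fun z hz => by
        simp only [mem_ofPred_eq, eval_aeval_pair, hAP, ← hP]
        exact hdist x hx y hy z hz)
    have hv' : v = ![(A x).coeff Q.natDegree, (A y).coeff Q.natDegree] := by
      ext i
      fin_cases i
      · simp [hAcoeff, ← hvx]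
      · simp [hAcoeff, ← hvy]
    rw [map_zero, hv', ← coeff_aeval_pair_mul he (hAdeg x) (hAdeg y) le_rfl, ← hid]
    refine Polynomial.coeff_eq_zero_of_natDegree_lt ((hAdeg _).trans_lt ?_)
    exact lt_mul_of_one_lt_left he hD
  have hp : p ≠ 0 := by
    rintro rfl
    simp at hD
  obtain ⟨m, hm, hmdeg⟩ := Finset.exists_mem_eq_sup p.support
    (MvPolynomial.support_nonempty.mpr hp) fun m => m.sum fun _ e => e
  have hcoeff := MvPolynomial.coeff_homogeneousComponent p.totalDegree p m
  rw [htop, if_pos (by rw [MvPolynomial.totalDegree, hmdeg]; rfl)] at hcoeff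
  exact MvPolynomial.mem_support_iff.mp hm hcoeff.symm
end

section
/- If f : ℝ × ℝ → ℝ is given by a power series centered at (0,0) that converges on [0,1] × [0,1] (in particular, f is real-analytic there), f maps [0,1] × [0,1] into [0,1], f(x,x) = x for all x ∈ [0,1], f(f(x,y),z) = f(f(x,z),f(y,z)) for all x, y, z ∈ [0,1], and for each y ∈ [0,1] the map x ↦ f(x,y) is a homeomorphism of [0,1], then f(x,y) = x for all (x,y) ∈ [0,1] × [0,1]. -/
open Set Filter Topology

/-- A nonzero power series with summable coefficients and vanishing constant term is injective
on a right neighbourhood of `0`. -/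
theorem exists_injOn_Ico_of_summable_coeff (a : ℕ → ℝ) (ha : Summable fun j => |a j|)
    (h0 : a 0 = 0) (hne : ∃ j, a j ≠ 0) :
    ∃ ε > 0, InjOn (fun y : ℝ => ∑' j, a j * y ^ j) (Ico 0 ε) := by
  set B : ℝ → ℝ := fun y => ∑' j, a j * y ^ j with hB
  have hser : HasFPowerSeriesAt B (FormalMultilinearSeries.ofScalars ℝ a) 0 := by
    rw [hasFPowerSeriesAt_iff]
    filter_upwards [Metric.ball_mem_nhds (0 : ℝ) one_pos] with z hz
    have hz1 : |z| ≤ 1 := by simpa using (mem_ball_zero_iff.1 hz).le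
    have hs : Summable fun j => a j * z ^ j := by
      refine Summable.of_norm_bounded ha fun j => ?_
      rw [Real.norm_eq_abs, abs_mul, abs_pow]
      exact mul_le_of_le_one_right (abs_nonneg _) (pow_le_one₀ (abs_nonneg _) hz1)
    simpa [hB, FormalMultilinearSeries.coeff_ofScalars, mul_comm] using hs.hasSum
  have hB0 : B 0 = 0 := by
    rw [hB]
    refine (tsum_eq_single 0 fun j hj => by simp [hj]).trans (by simp [h0])
  have han : AnalyticAt ℝ B 0 := hser.analyticAt
  rcases han.deriv.eventually_eq_zero_or_eventually_ne_zero with h | h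
  · exfalso
    have hev : ∀ᶠ y in 𝓝 (0 : ℝ), B y = 0 := by
      obtain ⟨r, hr, hball⟩ := Metric.eventually_nhds_iff_ball.1
        (h.and han.eventually_analyticAt)
      filter_upwards [Metric.ball_mem_nhds (0 : ℝ) hr] with y hy
      have := (convex_ball (0 : ℝ) r).is_const_of_fderivWithin_eq_zero (𝕜 := ℝ) (f := B)
        (fun x hx => (hball x hx).2.differentiableAt.differentiableWithinAt)
        (fun x hx => by
          rw [fderivWithin_of_isOpen Metric.isOpen_ball hx, ← toSpanSingleton_deriv,
            (hball x hx).1]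
          simp) hy (Metric.mem_ball_self hr)
      rw [this, hB0]
    obtain ⟨j, hj⟩ := hne
    have hp := HasFPowerSeriesAt.eq_zero (hser.congr hev)
    have hpj := congrArg (fun p => FormalMultilinearSeries.coeff p j) hp
    exact hj (FormalMultilinearSeries.coeff_ofScalars.symm.trans hpj)
  · rw [eventually_nhdsWithin_iff] at h
    obtain ⟨ε, hε, hball⟩ := Metric.eventually_nhds_iff_ball.1
      (h.and han.eventually_analyticAt)
    have hmem : ∀ x ∈ Ico (0 : ℝ) ε, x ∈ Metric.ball (0 : ℝ) ε := fun x hx => by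
      simpa [abs_of_nonneg hx.1] using hx.2
    refine ⟨ε, hε, ?_⟩
    have key : ∀ x ∈ Ico (0 : ℝ) ε, ∀ y ∈ Ico (0 : ℝ) ε, x < y → B x ≠ B y := by
      intro x hx y hy hxy hBxy
      obtain ⟨t, ht, hdt⟩ := exists_deriv_eq_zero hxy
        (fun s hs => (hball s (hmem s ⟨hx.1.trans hs.1, hs.2.trans_lt hy.2⟩)).2.continuousAt
          |>.continuousWithinAt) hBxy
      have ht0 : 0 < t := hx.1.trans_lt ht.1
      exact (hball t (hmem t ⟨ht0.le, ht.2.trans hy.2⟩)).1 ht0.ne' hdt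
    intro x hx y hy hxy
    rcases lt_trichotomy x y with h | h | h
    · exact absurd hxy (key x hx y hy h)
    · exact h
    · exact absurd hxy.symm (key y hy x hx h)

/-- A double power series with summable coefficients, restricted to the unit square, extends to
a continuous function on the plane. -/
theorem exists_continuous_tsum_unit_square (d : ℕ → ℕ → ℝ)
    (hd : Summable fun ij : ℕ × ℕ => |d ij.1 ij.2|) :
    ∃ E : ℝ → ℝ → ℝ, Continuous (Function.uncurry E) ∧
      ∀ x ∈ Icc (0 : ℝ) 1, ∀ y ∈ Icc (0 : ℝ) 1,
        HasSum (fun ij : ℕ × ℕ => d ij.1 ij.2 * x ^ ij.1 * y ^ ij.2) (E x y) := by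
  set cl : ℝ → ℝ := fun x => projIcc (0 : ℝ) 1 zero_le_one x with hcl
  have hcl_cont : Continuous cl := continuous_subtype_val.comp continuous_projIcc
  have hcl_mem : ∀ x, cl x ∈ Icc (0 : ℝ) 1 := fun x => (projIcc (0 : ℝ) 1 zero_le_one x).2
  have hbound : ∀ (ij : ℕ × ℕ) (x y : ℝ),
      ‖d ij.1 ij.2 * cl x ^ ij.1 * cl y ^ ij.2‖ ≤ |d ij.1 ij.2| := by
    intro ij x y
    have hx := hcl_mem x
    have hy := hcl_mem y
    rw [Real.norm_eq_abs, mul_assoc, abs_mul]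
    refine mul_le_of_le_one_right (abs_nonneg _) ?_
    rw [abs_of_nonneg (mul_nonneg (pow_nonneg hx.1 _) (pow_nonneg hy.1 _))]
    exact mul_le_one₀ (pow_le_one₀ hx.1 hx.2) (pow_nonneg hy.1 _) (pow_le_one₀ hy.1 hy.2)
  refine ⟨fun x y => ∑' ij : ℕ × ℕ, d ij.1 ij.2 * cl x ^ ij.1 * cl y ^ ij.2, ?_, ?_⟩
  · exact continuous_tsum (fun ij => by fun_prop) hd fun ij p => hbound ij p.1 p.2
  · intro x hx y hy
    have := (Summable.of_norm_bounded hd fun ij => hbound ij x y).hasSum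
    have hx' : cl x = x := by simp [hcl, projIcc_of_mem zero_le_one hx]
    have hy' : cl y = y := by simp [hcl, projIcc_of_mem zero_le_one hy]
    simpa only [hx', hy'] using this

/-- Two continuous functions which agree on `(0, r)` agree at `0`. -/
theorem Continuous.apply_zero_eq_of_eqOn_Ioo {φ ψ : ℝ → ℝ} (hφ : Continuous φ) (hψ : Continuous ψ)
    {r : ℝ} (hr : 0 < r) (h : EqOn φ ψ (Ioo 0 r)) : φ 0 = ψ 0 := by
  refine h.closure hφ hψ ?_
  rw [closure_Ioo hr.ne]
  exact left_mem_Icc.2 hr.le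

/-- A homeomorphism of the unit interval maps `0` to an endpoint. -/
theorem unitInterval.homeomorph_zero (h : unitInterval ≃ₜ unitInterval) : h 0 = 0 ∨ h 0 = 1 := by
  rcases h.continuous.strictMono_of_inj h.injective with hm | hm
  · left
    obtain ⟨t, ht⟩ := h.surjective 0
    exact le_antisymm ((hm.monotone (unitInterval.nonneg' (t := t))).trans ht.le)
      unitInterval.nonneg'
  · right
    obtain ⟨t, ht⟩ := h.surjective 1
    exact le_antisymm unitInterval.le_one'
      (ht.ge.trans (hm.antitone (unitInterval.nonneg' (t := t))))

/-- A nonzero double power series `F` converging on the unit square factors as `x ^ k * E x y` with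
`E` continuous, and `E 0` is injective near `0` if it vanishes at `0`. -/
theorem exists_eq_pow_mul_of_hasSum (F : ℝ → ℝ → ℝ) (d : ℕ → ℕ → ℝ)
    (hF : ∀ x ∈ Icc (0 : ℝ) 1, ∀ y ∈ Icc (0 : ℝ) 1,
      HasSum (fun ij : ℕ × ℕ => d ij.1 ij.2 * x ^ ij.1 * y ^ ij.2) (F x y))
    (hne : ∃ i j, d i j ≠ 0) :
    ∃ (k : ℕ) (E : ℝ → ℝ → ℝ), Continuous (Function.uncurry E) ∧
      (∀ x ∈ Icc (0 : ℝ) 1, ∀ y ∈ Icc (0 : ℝ) 1, F x y = x ^ k * E x y) ∧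
      (E 0 0 = 0 → ∃ ε > 0, ε ≤ 1 ∧ InjOn (E 0) (Ico 0 ε)) := by
  have m0 : (0 : ℝ) ∈ Icc (0 : ℝ) 1 := left_mem_Icc.2 zero_le_one
  have m1 : (1 : ℝ) ∈ Icc (0 : ℝ) 1 := right_mem_Icc.2 zero_le_one
  have hdsum : Summable fun ij : ℕ × ℕ => |d ij.1 ij.2| := by
    simpa using (hF 1 m1 1 m1).summable.abs
  obtain ⟨k, hkne, hkmin⟩ : ∃ k, (∃ j, d k j ≠ 0) ∧ ∀ i < k, ∀ j, d i j = 0 := by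
    classical
    refine ⟨Nat.find hne, Nat.find_spec hne, fun i hi j => ?_⟩
    by_contra h
    exact Nat.find_min hne hi ⟨j, h⟩
  have hinj : Function.Injective fun ij : ℕ × ℕ => (ij.1 + k, ij.2) := by
    rintro ⟨i, j⟩ ⟨i', j'⟩ h
    simpa using h
  have hdsum' : Summable fun ij : ℕ × ℕ => |d (ij.1 + k) ij.2| := by
    simpa only [Function.comp_def] using hdsum.comp_injective hinj
  obtain ⟨E, hEc, hE⟩ := exists_continuous_tsum_unit_square (fun i j => d (i + k) j) hdsum'
  have hFE : ∀ x ∈ Icc (0 : ℝ) 1, ∀ y ∈ Icc (0 : ℝ) 1, F x y = x ^ k * E x y := by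
    intro x hx y hy
    have h1 : HasSum (fun ij : ℕ × ℕ => d (ij.1 + k) ij.2 * x ^ (ij.1 + k) * y ^ ij.2)
        (F x y) := by
      have h := (hinj.hasSum_iff (a := F x y)
        (f := fun ij : ℕ × ℕ => d ij.1 ij.2 * x ^ ij.1 * y ^ ij.2) ?_).2 (hF x hx y hy)
      · simpa only [Function.comp_def] using h
      rintro ⟨i, j⟩ hij
      have : i < k := by
        by_contra hlt
        exact hij ⟨(i - k, j), by simp [Nat.sub_add_cancel (not_lt.1 hlt)]⟩
      simp [hkmin i this j]
    have h2 := (hE x hx y hy).mul_left (x ^ k)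
    refine h1.unique (h2.congr_fun fun ij => ?_)
    rw [pow_add]
    ring
  have hb : ∀ y ∈ Icc (0 : ℝ) 1, HasSum (fun j => d k j * y ^ j) (E 0 y) := by
    intro y hy
    have hi : Function.Injective fun j : ℕ => ((0, j) : ℕ × ℕ) := Prod.mk_right_injective 0
    have := (hi.hasSum_iff (f := fun ij : ℕ × ℕ => d (ij.1 + k) ij.2 * 0 ^ ij.1 * y ^ ij.2)
        ?_).2 (hE 0 m0 y hy)
    · simpa [Function.comp_def] using this
    · rintro ⟨i, j⟩ hij
      have : i ≠ 0 := by
        rintro rfl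
        exact hij ⟨j, rfl⟩
      simp [this]
  refine ⟨k, E, hEc, hFE, fun hE0 => ?_⟩
  have hdk0 : d k 0 = 0 := by
    have h1 := (hasSum_single (f := fun j => d k j * (0 : ℝ) ^ j) 0
      (fun j hj => by simp [hj])).unique (hb 0 m0)
    simpa [hE0] using h1
  have hdksum : Summable fun j => |d k j| := by
    simpa only [Function.comp_def] using hdsum.comp_injective (Prod.mk_right_injective k)
  obtain ⟨ε, hε, hBinj⟩ := exists_injOn_Ico_of_summable_coeff (d k) hdksum hdk0 hkne
  refine ⟨min ε 1, by positivity, min_le_right _ _, ?_⟩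
  refine (hBinj.mono (Ico_subset_Ico_right (min_le_left _ _))).congr fun y hy => ?_
  exact (hb y ⟨hy.1, hy.2.le.trans (min_le_right _ _)⟩).tsum_eq

/-- If `f(x,y) = Σ c_{ij} x^i y^j` is given by a power series centered at `(0,0)`
converging on `[0,1]²`, maps `[0,1]²` into `[0,1]`, is idempotent and right
self-distributive on `[0,1]`, and each of its right translations is a homeomorphism of
`[0,1]`, then `f(x,y) = x` on `[0,1]²`. -/
theorem stmt19 (f : ℝ → ℝ → ℝ) (c : ℕ → ℕ → ℝ)
    (hseries : ∀ x ∈ Icc (0 : ℝ) 1, ∀ y ∈ Icc (0 : ℝ) 1,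
      HasSum (fun ij : ℕ × ℕ => c ij.1 ij.2 * x ^ ij.1 * y ^ ij.2) (f x y))
    (hmaps : ∀ x ∈ Icc (0 : ℝ) 1, ∀ y ∈ Icc (0 : ℝ) 1, f x y ∈ Icc (0 : ℝ) 1)
    (hidem : ∀ x ∈ Icc (0 : ℝ) 1, f x x = x)
    (hdist : ∀ x ∈ Icc (0 : ℝ) 1, ∀ y ∈ Icc (0 : ℝ) 1, ∀ z ∈ Icc (0 : ℝ) 1,
      f (f x y) z = f (f x z) (f y z))
    (hhomeo : ∀ y ∈ Icc (0 : ℝ) 1,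
      ∃ h : unitInterval ≃ₜ unitInterval, ∀ x : unitInterval, (h x : ℝ) = f x y) :
    ∀ x ∈ Icc (0 : ℝ) 1, ∀ y ∈ Icc (0 : ℝ) 1, f x y = x := by
  have m0 : (0 : ℝ) ∈ Icc (0 : ℝ) 1 := left_mem_Icc.2 zero_le_one
  -- `d` collects the coefficients of `f x y - x`.
  set d : ℕ → ℕ → ℝ := fun i j => c i j - if (i, j) = (1, 0) then 1 else 0 with hd_def
  have hdser : ∀ x ∈ Icc (0 : ℝ) 1, ∀ y ∈ Icc (0 : ℝ) 1,
      HasSum (fun ij : ℕ × ℕ => d ij.1 ij.2 * x ^ ij.1 * y ^ ij.2) (f x y - x) := by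
    intro x hx y hy
    have h1 : HasSum (fun ij : ℕ × ℕ => if ij = (1, 0) then x else 0) x :=
      hasSum_ite_eq (1, 0) x
    refine ((hseries x hx y hy).sub h1).congr_fun ?_
    rintro ⟨i, j⟩
    by_cases h : (i, j) = (1, 0)
    · obtain ⟨rfl, rfl⟩ := Prod.mk.inj h
      simp [hd_def, sub_mul]
    · simp only [hd_def, h, if_false, sub_zero]
  by_cases hne : ∃ i j, d i j ≠ 0
  swap
  · push Not at hne
    intro x hx y hy
    have h0 := hdser x hx y hy
    simp only [hne, zero_mul] at h0
    exact sub_eq_zero.1 (h0.unique hasSum_zero)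
  exfalso
  obtain ⟨k, E, hEc, hfE', hEinj⟩ := exists_eq_pow_mul_of_hasSum (fun x y => f x y - x) d hdser hne
  have hfE : ∀ x ∈ Icc (0 : ℝ) 1, ∀ y ∈ Icc (0 : ℝ) 1, f x y = x + x ^ k * E x y :=
    fun x hx y hy => sub_eq_iff_eq_add'.1 (hfE' x hx y hy)
  have hEc1 : ∀ y, Continuous fun x => E x y := fun y =>
    hEc.comp (Continuous.prodMk_left y)
  have hEc2 : ∀ x, Continuous fun y => E x y := fun x =>
    hEc.comp (Continuous.prodMk_right x)
  have hb0 : E 0 0 = 0 := by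
    refine Continuous.apply_zero_eq_of_eqOn_Ioo (φ := fun x => E x x) (ψ := fun _ => 0)
      (hEc.comp (continuous_id.prodMk continuous_id)) continuous_const one_pos ?_
    intro x hx
    have hx' := Ioo_subset_Icc_self hx
    have h1 := hfE x hx' x hx'
    rw [hidem x hx'] at h1
    have : x ^ k * E x x = 0 := by linarith
    exact (mul_eq_zero.1 this).resolve_left (pow_ne_zero _ hx.1.ne')
  obtain ⟨ε, hε, hε1, hEinj⟩ := hEinj hb0
  -- `0` is fixed by all translations, hence `k` is positive.
  have hf0 : ∀ y ∈ Icc (0 : ℝ) 1, f 0 y = 0 := by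
    have hends : ∀ y ∈ Icc (0 : ℝ) 1, f 0 y = 0 ∨ f 0 y = 1 := by
      intro y hy
      obtain ⟨h, hh⟩ := hhomeo y hy
      have h0 : (h 0 : ℝ) = f 0 y := hh 0
      rcases unitInterval.homeomorph_zero h with h1 | h1 <;> rw [← h0, h1] <;> simp
    intro y hy
    refine (hends y hy).resolve_right fun h1 => ?_
    have hc : ContinuousOn (fun t => f 0 t) (Icc 0 y) :=
      (Continuous.continuousOn (f := fun t => 0 + 0 ^ k * E 0 t)
        (by have := hEc2 0; fun_prop)).congr
        fun t ht => hfE 0 m0 t ⟨ht.1, ht.2.trans hy.2⟩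
    obtain ⟨t, ht, hft⟩ := intermediate_value_Icc hy.1 hc
      (show (1 / 2 : ℝ) ∈ Icc (f 0 0) (f 0 y) by rw [hidem 0 m0, h1]; norm_num)
    rcases hends t ⟨ht.1, ht.2.trans hy.2⟩ with h | h <;> norm_num [h] at hft
  have hk1 : k ≠ 0 := by
    rintro rfl
    have hm : ε / 2 ∈ Icc (0 : ℝ) 1 := ⟨by linarith, by linarith⟩
    have h1 := hfE 0 m0 _ hm
    rw [hf0 _ hm] at h1
    have := hEinj ⟨le_rfl, hε⟩ (show ε / 2 ∈ Ico 0 ε from ⟨by linarith, by linarith⟩)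
      (by rw [hb0]; linarith)
    linarith
  -- Comparing the terms of order `x ^ k` in the distributive law.
  have hlead : ∀ y ∈ Icc (0 : ℝ) 1, ∀ z ∈ Icc (0 : ℝ) 1, 1 + E 0 z ≠ 0 →
      E 0 y = E 0 (f y z) := by
    intro y hy z hz hne
    obtain ⟨n, hn⟩ := Nat.exists_eq_succ_of_ne_zero hk1
    have hw := hmaps y hy z hz
    have hcy := hEc1 y
    have hcz := hEc1 z
    have hcw := hEc1 (f y z)
    have hlim := Continuous.apply_zero_eq_of_eqOn_Ioo
      (φ := fun x => E x y + (1 + x ^ n * E x y) ^ k * E (x + x ^ k * E x y) z)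
      (ψ := fun x => E x z + (1 + x ^ n * E x z) ^ k * E (x + x ^ k * E x z) (f y z))
      (by fun_prop) (by fun_prop) one_pos (by
        intro x hx
        have hx' := Ioo_subset_Icc_self hx
        have h := hdist x hx' y hy z hz
        have hu := hmaps x hx' y hy
        have hv := hmaps x hx' z hz
        rw [hfE _ hu z hz, hfE _ hv _ hw, hfE x hx' y hy, hfE x hx' z hz] at h
        have hpow : ∀ t, (x + x ^ k * t) ^ k = x ^ k * (1 + x ^ n * t) ^ k := by
          intro t
          rw [← mul_pow]
          congr 1
          rw [hn, pow_succ]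
          ring
        rw [hpow, hpow] at h
        refine mul_left_cancel₀ (pow_ne_zero k hx.1.ne') ?_
        linear_combination h)
    simp only [zero_pow hk1, zero_mul, add_zero] at hlim
    rcases Nat.eq_zero_or_pos n with rfl | hnpos
    · rw [hn] at hlim
      norm_num at hlim
      refine mul_left_cancel₀ hne ?_
      linear_combination hlim
    · simp only [zero_pow hnpos.ne', zero_mul, add_zero, one_pow, one_mul] at hlim
      linarith
  -- Near the origin `f y z = y`.
  have hnear : ∃ r > 0, r ≤ 1 ∧ ∀ y ∈ Ico (0 : ℝ) r, ∀ z ∈ Ico (0 : ℝ) r, f y z = y := by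
    have hcont : Continuous fun p : ℝ × ℝ => p.1 + p.1 ^ k * E p.1 p.2 := by
      have : Continuous fun p : ℝ × ℝ => E p.1 p.2 := hEc
      fun_prop
    have hc0 : Continuous fun p : ℝ × ℝ => 1 + E 0 p.2 :=
      continuous_const.add (hEc.comp (by fun_prop : Continuous fun p : ℝ × ℝ => ((0 : ℝ), p.2)))
    have e1 : ∀ᶠ p in 𝓝 ((0 : ℝ), (0 : ℝ)), p.1 + p.1 ^ k * E p.1 p.2 < ε :=
      hcont.continuousAt.eventually_lt continuousAt_const (by simpa [hk1] using hε)
    have e2 : ∀ᶠ p in 𝓝 ((0 : ℝ), (0 : ℝ)), 1 + E 0 p.2 ≠ 0 :=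
      hc0.continuousAt.eventually_ne (by simp [hb0])
    obtain ⟨r, hr, hball⟩ := Metric.eventually_nhds_iff_ball.1 (e1.and e2)
    refine ⟨min r ε, by positivity, (min_le_right _ _).trans hε1, ?_⟩
    intro y hy z hz
    simp only [mem_Ico, lt_min_iff] at hy hz
    have hy' : y ∈ Icc (0 : ℝ) 1 := ⟨hy.1, hy.2.2.le.trans hε1⟩
    have hz' : z ∈ Icc (0 : ℝ) 1 := ⟨hz.1, hz.2.2.le.trans hε1⟩
    obtain ⟨h1, h2⟩ := hball (y, z) (by
      simp [Prod.dist_eq, abs_of_nonneg hy.1, abs_of_nonneg hz.1, hy.2.1, hz.2.1])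
    refine (hEinj ⟨hy.1, hy.2.2⟩ ⟨(hmaps y hy' z hz').1, ?_⟩ (hlead y hy' z hz' h2)).symm
    rw [hfE y hy' z hz']
    exact h1
  obtain ⟨r, hr, hr1, hfr⟩ := hnear
  -- Hence the leading coefficient vanishes near `0`, contradicting its injectivity there.
  have hEzero : ∀ z ∈ Ico (0 : ℝ) r, E 0 z = 0 := by
    intro z hz
    refine Continuous.apply_zero_eq_of_eqOn_Ioo (φ := fun x => E x z) (ψ := fun _ => 0)
      (hEc1 z) continuous_const hr ?_
    intro x hx
    have h1 := hfE x ⟨hx.1.le, hx.2.le.trans hr1⟩ z ⟨hz.1, hz.2.le.trans hr1⟩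
    rw [hfr x (Ioo_subset_Ico_self hx) z hz] at h1
    have : x ^ k * E x z = 0 := by linarith
    exact (mul_eq_zero.1 this).resolve_left (pow_ne_zero _ hx.1.ne')
  have hpos : 0 < min r ε / 2 := by positivity
  have hlt : min r ε / 2 < min r ε := by linarith
  have hltr := hlt.trans_le (min_le_left r ε)
  refine hpos.ne (hEinj ⟨le_rfl, hε⟩ ⟨hpos.le, hlt.trans_le (min_le_right r ε)⟩ ?_)
  rw [hb0, hEzero _ ⟨hpos.le, hltr⟩]
end
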